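/- Let A be a standard graded K-algebra and I ⊂ A a homogeneous ideal minimally generated in a single degree d, such that the Rees algebra R(I) = A[It], standard bigraded with deg(generators of m) = (1,0) and deg(f_i t) = (0,1), is Koszul. Then A is Koszul and for every j ≥ 0 the ideal power I^j has a linear A-resolution, i.e., Tor_i^A(I^j, K)_k = 0 for k ≠ i + dj. -/

import Mathlib

/-- The `j`-th graded component of the graded free module `σ →₀ A` with basis
elements of degrees `deg`. -/
def freeGrading {K A ι : Type} [Field K] [CommRing A] [Algebra K A] [AddCommGroup ι]
    (𝒜 : ι → Submodule K A) {σ : Type} (deg : σ → ι) (j : ι) : Submodule K (σ →₀ A) where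
  carrier := {f | ∀ s, f s ∈ 𝒜 (j - deg s)}
  add_mem' := fun {f g} hf hg s => by
    rw [Finsupp.add_apply]; exact add_mem (hf s) (hg s)
  zero_mem' := fun s => by simp
  smul_mem' := fun c f hf s => by
    rw [Finsupp.smul_apply]; exact Submodule.smul_mem _ c (hf s)

/-- A map of graded modules has degree `0`. -/
def IsGradedMap {K A ι M N : Type} [Field K] [CommRing A] [Algebra K A] [AddCommGroup ι]
    [AddCommGroup M] [Module A M] [AddCommGroup N] [Module A N]
    [Module K M] [Module K N]
    (ℳ : ι → Submodule K M) (𝒩 : ι → Submodule K N) (φ : M →ₗ[A] N) : Prop :=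
  ∀ j : ι, ∀ x ∈ ℳ j, φ x ∈ 𝒩 j

/-- A graded free resolution of the graded module `(M, ℳ)` over the graded algebra
`(A, 𝒜)`, in which the `s`-th free module has basis elements of degrees lying in
the prescribed set `D s`.  The existence of such a resolution with
`D s = {j | j ≤ b s}` is equivalent to the vanishing `Tor_s^A(M, K)_j = 0` for all
`j > b s`, i.e. to `t_s(M) ≤ b s` (for all `s` simultaneously). -/
structure GradedFreeResolution (K A : Type) [Field K] [CommRing A] [Algebra K A]
    {ι : Type} [AddCommGroup ι] (𝒜 : ι → Submodule K A)
    (M : Type) [AddCommGroup M] [Module A M] [Module K M]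
    (ℳ : ι → Submodule K M) (D : ℕ → Set ι) where
  σ : ℕ → Type
  deg : (s : ℕ) → σ s → ι
  deg_mem : ∀ (s : ℕ) (i : σ s), deg s i ∈ D s
  aug : (σ 0 →₀ A) →ₗ[A] M
  d : (s : ℕ) → ((σ (s+1) →₀ A) →ₗ[A] (σ s →₀ A))
  aug_surjective : Function.Surjective aug
  aug_graded : IsGradedMap (K := K) (freeGrading 𝒜 (deg 0)) ℳ aug
  d_graded : ∀ s : ℕ,
    IsGradedMap (K := K) (freeGrading 𝒜 (deg (s+1))) (freeGrading 𝒜 (deg s)) (d s)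
  exact_zero : LinearMap.range (d 0) = LinearMap.ker aug
  exact_succ : ∀ s : ℕ, LinearMap.range (d (s+1)) = LinearMap.ker (d s)

/-- The irrelevant ideal of a graded algebra. -/
def irrelevant {K B ι : Type} [Field K] [CommRing B] [Algebra K B] [AddCommGroup ι]
    (ℬ : ι → Submodule K B) : Ideal B :=
  Ideal.span {x | ∃ i : ι, i ≠ 0 ∧ x ∈ ℬ i}

/-- The grading of the residue field `B ⧸ B₊`, concentrated in degree `0`. -/
def residueGrading (K B : Type) [Field K] [CommRing B] [Algebra K B] {ι : Type}
    [AddCommGroup ι] [DecidableEq ι] (ℬ : ι → Submodule K B) :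
    ι → Submodule K (B ⧸ irrelevant ℬ) :=
  fun i => if i = 0 then ⊤ else ⊥

/-- A positively `ℤ`-graded `K`-algebra is Koszul if the residue field has a linear
graded free resolution. -/
def IsKoszul (K B : Type) [Field K] [CommRing B] [Algebra K B]
    (ℬ : ℤ → Submodule K B) : Prop :=
  Nonempty (GradedFreeResolution K B ℬ (B ⧸ irrelevant ℬ) (residueGrading K B ℬ)
    (fun s => {(s : ℤ)}))

/-- A (positively) bigraded `K`-algebra is Koszul if the residue field has a free
resolution which is linear in the total degree. -/
def IsKoszulBi (K B : Type) [Field K] [CommRing B] [Algebra K B]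
    (ℬ : ℤ × ℤ → Submodule K B) : Prop :=
  Nonempty (GradedFreeResolution K B ℬ (B ⧸ irrelevant ℬ) (residueGrading K B ℬ)
    (fun s => {v : ℤ × ℤ | v.1 + v.2 = (s : ℤ)}))

/-- A bigraded algebra is standard if it is positively graded and generated by its
components of degrees `(1,0)` and `(0,1)` over the degree-`(0,0)` part `K`. -/
def IsStandardBigraded (K R : Type) [Field K] [CommRing R] [Algebra K R]
    (ℛ : ℤ × ℤ → Submodule K R) : Prop :=
  (∀ p : ℤ × ℤ, p.1 < 0 ∨ p.2 < 0 → ℛ p = ⊥) ∧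
  (ℛ (0, 0) = 1) ∧
  (∀ p : ℤ × ℤ, 0 ≤ p.1 → 0 ≤ p.2 →
    ℛ p = ℛ (1, 0) ^ p.1.toNat * ℛ (0, 1) ^ p.2.toNat)

/-- A `ℤ`-graded `K`-algebra is standard if it is positively graded, `𝒜 0 = K`, and
it is generated in degree `1`. -/
def IsStandardGraded (K A : Type) [Field K] [CommRing A] [Algebra K A]
    (𝒜 : ℤ → Submodule K A) : Prop :=
  (∀ i : ℤ, i < 0 → 𝒜 i = ⊥) ∧ (𝒜 0 = 1) ∧ (∀ n : ℕ, 𝒜 (n : ℤ) = 𝒜 1 ^ n)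

/-- The bigraded components of the Rees algebra `R(I) = A[It] ⊆ A[t]`, where the
generators of the maximal ideal of `A` get bidegree `(1,0)` and the elements `f·t`
with `f` a degree-`d` generator of `I` get bidegree `(0,1)`:  the component of
bidegree `(i,j)` is `(I^j ∩ A_{i+dj})·t^j`. -/
noncomputable def reesGrading (K A : Type) [Field K] [CommRing A] [Algebra K A]
    (𝒜 : ℤ → Submodule K A) (I : Ideal A) (d : ℕ) (p : ℤ × ℤ) :
    Submodule K (Polynomial A) :=
  Submodule.span K {f | ∃ (j : ℕ) (x : A), (j : ℤ) = p.2 ∧ x ∈ I ^ j ∧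
    x ∈ 𝒜 (p.1 + d * j) ∧ f = Polynomial.C x * Polynomial.X ^ j}

/-- The endomorphism of `σ →₀ M` given by a matrix with entries in `A`. -/
noncomputable def matrixAct {A σ M : Type} [CommRing A] [AddCommGroup M] [Module A M]
    (m : σ → σ →₀ A) : (σ →₀ M) →ₗ[A] (σ →₀ M) :=
  Finsupp.lsum A fun i => (m i).sum fun l a => a • Finsupp.lsingle l

section matrixAct

variable {A B σ M N : Type} [CommRing A] [CommRing B] [AddCommGroup M] [Module A M]
  [AddCommGroup N] [Module B N]

theorem matrixAct_single (m : σ → σ →₀ A) (i l : σ) (x : M) :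
    matrixAct m (Finsupp.single i x) l = m i l • x := by
  classical
  rw [matrixAct, Finsupp.lsum_single, Finsupp.sum, LinearMap.sum_apply, Finsupp.finsetSum_apply]
  simp only [LinearMap.smul_apply, Finsupp.lsingle_apply, Finsupp.smul_apply,
    Finsupp.single_apply, smul_ite, smul_zero]
  rw [Finset.sum_ite_eq']
  split_ifs with h
  · rfl
  · rw [Finsupp.notMem_support_iff.mp h, zero_smul]

theorem matrixAct_apply (m : σ → σ →₀ A) (f : σ →₀ M) (l : σ) :
    matrixAct m f l = ∑ i ∈ f.support, m i l • f i := by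
  conv_lhs => rw [← Finsupp.sum_single f, Finsupp.sum, map_sum, Finsupp.finsetSum_apply]
  simp only [matrixAct_single]

theorem matrixAct_apply_of_subset (m : σ → σ →₀ A) (f : σ →₀ M) (l : σ) {s : Finset σ}
    (hs : f.support ⊆ s) : matrixAct m f l = ∑ i ∈ s, m i l • f i := by
  rw [matrixAct_apply]
  refine Finset.sum_subset hs fun i _ hi => ?_
  rw [Finsupp.notMem_support_iff.mp hi, smul_zero]

theorem mapRange_matrixAct (m : σ → σ →₀ A) (m' : σ → σ →₀ B) (θ : M →+ N) (f : σ →₀ M)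
    (h : ∀ i l, θ (m i l • f i) = m' i l • θ (f i)) :
    Finsupp.mapRange.addMonoidHom θ (matrixAct m f) =
      matrixAct m' (Finsupp.mapRange.addMonoidHom θ f) := by
  ext l
  have hs : (Finsupp.mapRange.addMonoidHom θ f).support ⊆ f.support := by
    intro i
    simp only [Finsupp.mem_support_iff, Finsupp.mapRange.addMonoidHom_apply,
      Finsupp.mapRange_apply]
    exact fun h h' => h (by rw [h', map_zero])
  rw [matrixAct_apply_of_subset _ _ _ hs]
  simp only [Finsupp.mapRange.addMonoidHom_apply, Finsupp.mapRange_apply]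
  rw [matrixAct_apply, map_sum]
  exact Finset.sum_congr rfl fun i _ => h i l

theorem mapRange_linear_matrixAct {N : Type} [AddCommGroup N] [Module A N]
    (m : σ → σ →₀ A) (θ : M →ₗ[A] N) (f : σ →₀ M) :
    Finsupp.mapRange.linearMap θ (matrixAct m f) =
      matrixAct m (Finsupp.mapRange.linearMap θ f) :=
  mapRange_matrixAct m m θ.toAddMonoidHom f fun i l => θ.map_smul (m i l) (f i)

end matrixAct

/-- The elements of bidegree `κ` in the graded free module with basis elements of degrees `deg`
which are supported on the basis elements satisfying `S`. -/
def supportedPart {K B σ ι : Type} [Field K] [CommRing B] [Algebra K B] [AddCommGroup ι]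
    (ℬ : ι → Submodule K B) (deg : σ → ι) (S : σ → Prop) (κ : ι) : Submodule K (σ →₀ B) where
  carrier := {x | ∀ i, x i ∈ ℬ (κ - deg i) ∧ (¬ S i → x i = 0)}
  add_mem' := fun {x y} hx hy i => by
    refine ⟨add_mem (hx i).1 (hy i).1, fun h => ?_⟩
    rw [Finsupp.add_apply, (hx i).2 h, (hy i).2 h, add_zero]
  zero_mem' := fun i => by simp
  smul_mem' := fun c x hx i => by
    refine ⟨Submodule.smul_mem _ c (hx i).1, fun h => ?_⟩
    rw [Finsupp.smul_apply, (hx i).2 h, smul_zero]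

/-- The elements of bidegree `κ` in a tensor product of two graded free modules which are supported
on the pairs of basis elements satisfying `S` and `T`. -/
def supportedPart₂ {K B σ ι : Type} [Field K] [CommRing B] [Algebra K B] [AddCommGroup ι]
    (ℬ : ι → Submodule K B) (deg : σ → ι) (S T : σ → Prop) (κ : ι) :
    Submodule K (σ →₀ (σ →₀ B)) where
  carrier := {x | ∀ i, x i ∈ supportedPart ℬ deg T (κ - deg i) ∧ (¬ S i → x i = 0)}
  add_mem' := fun {x y} hx hy i => by
    refine ⟨add_mem (hx i).1 (hy i).1, fun h => ?_⟩
    rw [Finsupp.add_apply, (hx i).2 h, (hy i).2 h, add_zero]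
  zero_mem' := fun i => by simp
  smul_mem' := fun c x hx i => by
    refine ⟨Submodule.smul_mem _ c (hx i).1, fun h => ?_⟩
    rw [Finsupp.smul_apply, (hx i).2 h, smul_zero]

/-- The total degree of a bidegree. -/
def totalDegree (p : ℤ × ℤ) : ℤ := p.1 + p.2

/-- A linear bigraded free resolution of the residue field, with all free modules assembled into a
single one, given by the matrix `m` of its differential. -/
structure LinearResolution {K B σ : Type} [Field K] [CommRing B] [Algebra K B]
    (ℬ : ℤ × ℤ → Submodule K B) (deg : σ → ℤ × ℤ) (m : σ → σ →₀ B) (o : σ) : Prop where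
  eq_bot : ∀ p : ℤ × ℤ, p.1 < 0 ∨ p.2 < 0 → ℬ p = ⊥
  fst_nonneg : ∀ i, 0 ≤ (deg i).1
  snd_nonneg : ∀ i, 0 ≤ (deg i).2
  entry_mem : ∀ i l, m i l ∈ ℬ (deg i - deg l)
  entry_total : ∀ i l, m i l ≠ 0 → totalDegree (deg i) = totalDegree (deg l) + 1
  sq_zero : ∀ x : σ →₀ B, matrixAct m (matrixAct m x) = 0
  exact : ∀ (s : ℕ) (κ : ℤ × ℤ) (x : σ →₀ B),
    x ∈ supportedPart ℬ deg (fun i => totalDegree (deg i) = s) κ → matrixAct m x = 0 →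
    (κ ≠ 0 ∨ 1 ≤ s) →
    ∃ w ∈ supportedPart ℬ deg (fun i => totalDegree (deg i) = (s + 1 : ℕ)) κ, matrixAct m w = x
  deg_base : deg o = 0
  eq_base : ∀ i, totalDegree (deg i) = 0 → i = o

section LinearResolution

variable {K B σ τ : Type} [Field K] [CommRing B] [Algebra K B]

theorem supportedPart_mono {ι : Type} [AddCommGroup ι] {ℬ : ι → Submodule K B} {deg : σ → ι}
    {S T : σ → Prop} {κ : ι} (hST : ∀ i, S i → T i) {x : σ →₀ B}
    (hx : x ∈ supportedPart ℬ deg S κ) : x ∈ supportedPart ℬ deg T κ :=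
  fun i => ⟨(hx i).1, fun h => (hx i).2 fun h' => h (hST i h')⟩

theorem eq_zero_of_mem_supportedPart {ι : Type} [AddCommGroup ι] {ℬ : ι → Submodule K B}
    {deg : σ → ι} {S : σ → Prop} {κ : ι} (hS : ∀ i, ¬ S i) {x : σ →₀ B}
    (hx : x ∈ supportedPart ℬ deg S κ) : x = 0 :=
  Finsupp.ext fun i => (hx i).2 (hS i)

theorem single_mem_supportedPart {ι : Type} [AddCommGroup ι] {ℬ : ι → Submodule K B}
    {deg : σ → ι} {S : σ → Prop} {κ : ι} {i : σ} (hi : S i) {b : B} (hb : b ∈ ℬ (κ - deg i)) :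
    Finsupp.single i b ∈ supportedPart ℬ deg S κ := by
  classical
  intro l
  rw [Finsupp.single_apply]
  split_ifs with h
  · subst h
    exact ⟨hb, fun h => absurd hi h⟩
  · exact ⟨zero_mem _, fun _ => rfl⟩

theorem eq_zero_of_mem_supportedPart₂ {ι : Type} [AddCommGroup ι] {ℬ : ι → Submodule K B}
    {deg : σ → ι} {S T : σ → Prop} {κ : ι} (hS : (∀ i, ¬ S i) ∨ ∀ i, ¬ T i) {x : σ →₀ σ →₀ B}
    (hx : x ∈ supportedPart₂ ℬ deg S T κ) : x = 0 := by
  rcases hS with hS | hS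
  · exact Finsupp.ext fun i => (hx i).2 (hS i)
  · exact Finsupp.ext fun i => eq_zero_of_mem_supportedPart hS (hx i).1

theorem supportedPart₂_sub_mem {ι : Type} [AddCommGroup ι] {ℬ : ι → Submodule K B}
    {deg : σ → ι} {S T : σ → Prop} {κ : ι} {x y : σ →₀ σ →₀ B}
    (hx : x ∈ supportedPart₂ ℬ deg S T κ) (hy : y ∈ supportedPart₂ ℬ deg S T κ) :
    x - y ∈ supportedPart₂ ℬ deg S T κ := by
  refine fun i => ⟨?_, fun h => ?_⟩
  · rw [Finsupp.sub_apply]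
    exact Submodule.sub_mem _ (hx i).1 (hy i).1
  · rw [Finsupp.sub_apply, (hx i).2 h, (hy i).2 h, sub_zero]

theorem matrixAct_mem {ι : Type} [AddCommGroup ι] [DecidableEq ι] {ℬ : ι → Submodule K B}
    [GradedAlgebra ℬ] {deg : σ → ι} {m : σ → σ →₀ B} (hm : ∀ i l, m i l ∈ ℬ (deg i - deg l))
    {S T : σ → Prop} {κ : ι} (hST : ∀ i l, S i → m i l ≠ 0 → T l)
    {x : σ →₀ B} (hx : x ∈ supportedPart ℬ deg S κ) :
    matrixAct m x ∈ supportedPart ℬ deg T κ := by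
  intro l
  rw [matrixAct_apply]
  constructor
  · refine Submodule.sum_mem _ fun i _ => ?_
    have := SetLike.mul_mem_graded (hm i l) (hx i).1
    rwa [show deg i - deg l + (κ - deg i) = κ - deg l by abel] at this
  · intro hl
    refine Finset.sum_eq_zero fun i _ => ?_
    by_cases hi : S i
    · by_cases h0 : m i l = 0
      · rw [h0, zero_smul]
      · exact absurd (hST i l hi h0) hl
    · rw [(hx i).2 hi, smul_zero]

/-- The differential of a tensor product of two free modules acting on the second factor. -/
noncomputable def rightAct (m : σ → σ →₀ B) : (σ →₀ σ →₀ B) →ₗ[B] (σ →₀ σ →₀ B) :=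
  Finsupp.mapRange.linearMap (matrixAct m)

/-- The column of an element of a tensor product of two free modules. -/
noncomputable def column (i : τ) : (σ →₀ τ →₀ B) →ₗ[B] (σ →₀ B) :=
  Finsupp.mapRange.linearMap (Finsupp.lapply i)

theorem column_apply (i : τ) (l : σ) (x : σ →₀ τ →₀ B) : column i x l = x l i := rfl

theorem column_sub (i : τ) (x y : σ →₀ τ →₀ B) : column i (x - y) = column i x - column i y := by
  refine Finsupp.ext fun l => ?_
  rw [column_apply, Finsupp.sub_apply, Finsupp.sub_apply, Finsupp.sub_apply, column_apply, column_apply]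

theorem rightAct_apply (m : σ → σ →₀ B) (x : σ →₀ σ →₀ B) (i : σ) :
    rightAct m x i = matrixAct m (x i) := rfl

theorem column_matrixAct (m : σ → σ →₀ B) (i : τ) (x : σ →₀ τ →₀ B) :
    column i (matrixAct m x) = matrixAct m (column i x) :=
  mapRange_linear_matrixAct m _ x

theorem rightAct_matrixAct (m : σ → σ →₀ B) (x : σ →₀ σ →₀ B) :
    rightAct m (matrixAct m x) = matrixAct m (rightAct m x) :=
  mapRange_linear_matrixAct m _ x

theorem column_ext {x y : σ →₀ τ →₀ B} (h : ∀ i, column i x = column i y) : x = y :=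
  Finsupp.ext fun i => Finsupp.ext fun l => DFunLike.congr_fun (h l) i

theorem column_mem {ι : Type} [AddCommGroup ι] {ℬ : ι → Submodule K B} {deg : σ → ι}
    {S T : σ → Prop} {κ : ι} {x : σ →₀ σ →₀ B} (hx : x ∈ supportedPart₂ ℬ deg S T κ) (i : σ) :
    column i x ∈ supportedPart ℬ deg S (κ - deg i) := by
  intro l
  rw [column_apply]
  refine ⟨?_, fun h => by rw [(hx l).2 h]; rfl⟩
  have := ((hx l).1 i).1
  rwa [show κ - deg i - deg l = κ - deg l - deg i by abel]

theorem mem_supportedPart₂_of_column {ι : Type} [AddCommGroup ι] {ℬ : ι → Submodule K B}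
    {deg : σ → ι} {S T : σ → Prop} {κ : ι} {x : σ →₀ σ →₀ B}
    (hx : ∀ i, column i x ∈ supportedPart ℬ deg S (κ - deg i))
    (hT : ∀ i, ¬ T i → column i x = 0) : x ∈ supportedPart₂ ℬ deg S T κ := by
  intro l
  refine ⟨fun i => ⟨?_, fun h => ?_⟩, fun h => Finsupp.ext fun i => ((hx i) l).2 h⟩
  · have := ((hx i) l).1
    rwa [show κ - deg i - deg l = κ - deg l - deg i by abel] at this
  · exact DFunLike.congr_fun (hT i h) l

theorem single_column (i j : τ) (c : σ →₀ B) [DecidableEq τ] :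
    column i (Finsupp.mapRange.linearMap (Finsupp.lsingle (R := B) j) c) =
      if j = i then c else 0 := by
  ext l
  rw [column_apply, Finsupp.mapRange.linearMap_apply, Finsupp.mapRange_apply,
    Finsupp.lsingle_apply, Finsupp.single_apply]
  split_ifs <;> rfl

/-- An element of a tensor product can be prescribed by finitely many nonzero columns. -/
theorem exists_column_eq (c : τ → σ →₀ B) (s : Finset τ) (hc : ∀ i ∉ s, c i = 0) :
    ∃ y : σ →₀ τ →₀ B, ∀ i, column i y = c i := by
  classical
  refine ⟨∑ j ∈ s, Finsupp.mapRange.linearMap (Finsupp.lsingle (R := B) j) (c j), fun i => ?_⟩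
  rw [map_sum]
  simp only [single_column]
  rw [Finset.sum_ite_eq']
  split_ifs with h
  · rfl
  · exact (hc i h).symm

theorem exists_finset_column (x : σ →₀ τ →₀ B) : ∃ s : Finset τ, ∀ i ∉ s, column i x = 0 := by
  classical
  refine ⟨x.support.biUnion fun i => (x i).support, fun i hi => Finsupp.ext fun l => ?_⟩
  rw [column_apply]
  by_contra h
  refine hi (Finset.mem_biUnion.mpr ⟨l, ?_, Finsupp.mem_support_iff.mpr h⟩)
  rw [Finsupp.mem_support_iff]
  intro h'
  rw [h'] at h
  exact h rfl

theorem matrixAct_mem₂ {ι : Type} [AddCommGroup ι] [DecidableEq ι] {ℬ : ι → Submodule K B}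
    [GradedAlgebra ℬ] {deg : σ → ι} {m : σ → σ →₀ B} (hm : ∀ i l, m i l ∈ ℬ (deg i - deg l))
    {S S' T : σ → Prop} {κ : ι} (hST : ∀ i l, S i → m i l ≠ 0 → S' l)
    {x : σ →₀ σ →₀ B} (hx : x ∈ supportedPart₂ ℬ deg S T κ) :
    matrixAct m x ∈ supportedPart₂ ℬ deg S' T κ := by
  refine mem_supportedPart₂_of_column (fun i => ?_) (fun i hi => ?_)
  · rw [column_matrixAct]
    exact matrixAct_mem hm hST (column_mem hx i)
  · rw [column_matrixAct, show column i x = 0 from Finsupp.ext fun l => ((hx l).1 i).2 hi, map_zero]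

theorem rightAct_mem₂ {ι : Type} [AddCommGroup ι] [DecidableEq ι] {ℬ : ι → Submodule K B}
    [GradedAlgebra ℬ] {deg : σ → ι} {m : σ → σ →₀ B} (hm : ∀ i l, m i l ∈ ℬ (deg i - deg l))
    {S T T' : σ → Prop} {κ : ι} (hST : ∀ i l, T i → m i l ≠ 0 → T' l)
    {x : σ →₀ σ →₀ B} (hx : x ∈ supportedPart₂ ℬ deg S T κ) :
    rightAct m x ∈ supportedPart₂ ℬ deg S T' κ := by
  intro i
  rw [rightAct_apply]
  exact ⟨matrixAct_mem hm hST (hx i).1, fun h => by rw [(hx i).2 h, map_zero]⟩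

/-- The linear map on a tensor product with prescribed values on the basis elements. -/
noncomputable def pairing (ρ : σ → σ → σ →₀ B) : (σ →₀ σ →₀ B) →ₗ[B] (σ →₀ B) :=
  Finsupp.lsum B fun i => Finsupp.linearCombination B (ρ i)

theorem eq_of_eq_on_support (f g : (σ →₀ σ →₀ B) →ₗ[B] (σ →₀ B)) (x : σ →₀ σ →₀ B)
    (h : ∀ i j, x i j ≠ 0 → f (Finsupp.single i (Finsupp.single j 1)) =
      g (Finsupp.single i (Finsupp.single j 1))) : f x = g x := by
  rw [← Finsupp.sum_single x, Finsupp.sum, map_sum, map_sum]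
  refine Finset.sum_congr rfl fun i _ => ?_
  have : ∀ f : (σ →₀ σ →₀ B) →ₗ[B] (σ →₀ B), f (Finsupp.single i (x i)) =
      ∑ j ∈ (x i).support, x i j • f (Finsupp.single i (Finsupp.single j 1)) := by
    intro f
    conv_lhs => rw [← Finsupp.sum_single (x i), Finsupp.sum, Finsupp.single_finsetSum, map_sum]
    refine Finset.sum_congr rfl fun j _ => ?_
    rw [← map_smul, Finsupp.smul_single, Finsupp.smul_single, smul_eq_mul, mul_one]
  rw [this, this]
  exact Finset.sum_congr rfl fun j hj => by rw [h i j (Finsupp.mem_support_iff.mp hj)]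

theorem pairing_single (ρ : σ → σ → σ →₀ B) (i j : σ) :
    pairing ρ (Finsupp.single i (Finsupp.single j 1)) = ρ i j := by
  rw [pairing, Finsupp.lsum_single, Finsupp.linearCombination_single, one_smul]

theorem pairing_congr (ρ ρ' : σ → σ → σ →₀ B) (x : σ →₀ σ →₀ B)
    (h : ∀ i j, x i j ≠ 0 → ρ i j = ρ' i j) : pairing ρ x = pairing ρ' x :=
  eq_of_eq_on_support _ _ x fun i j hij => by rw [pairing_single, pairing_single, h i j hij]

theorem pairing_apply (ρ : σ → σ → σ →₀ B) (x : σ →₀ σ →₀ B) :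
    pairing ρ x = ∑ i ∈ x.support, ∑ j ∈ (x i).support, x i j • ρ i j := by
  rw [pairing, Finsupp.lsum_apply, Finsupp.sum]
  rfl

theorem pairing_mem {ι : Type} [AddCommGroup ι] [DecidableEq ι] {ℬ : ι → Submodule K B}
    [GradedAlgebra ℬ] {deg : σ → ι} {S T U : σ → Prop} {κ : ι} {ρ : σ → σ → σ →₀ B}
    (hρ : ∀ i j, S i → T j → ρ i j ∈ supportedPart ℬ deg U (deg i + deg j))
    {x : σ →₀ σ →₀ B} (hx : x ∈ supportedPart₂ ℬ deg S T κ) :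
    pairing ρ x ∈ supportedPart ℬ deg U κ := by
  rw [pairing_apply]
  refine Submodule.sum_mem _ fun i hi => Submodule.sum_mem _ fun j hj => ?_
  have hS : S i := by
    by_contra h
    exact (Finsupp.mem_support_iff.mp hi) ((hx i).2 h)
  have hT : T j := by
    by_contra h
    exact (Finsupp.mem_support_iff.mp hj) (((hx i).1 j).2 h)
  intro l
  rw [Finsupp.smul_apply, smul_eq_mul]
  refine ⟨?_, fun h => by rw [(hρ i j hS hT l).2 h, mul_zero]⟩
  have := SetLike.mul_mem_graded ((hx i).1 j).1 (hρ i j hS hT l).1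
  rwa [show κ - deg i - deg j + (deg i + deg j - deg l) = κ - deg l by abel] at this

end LinearResolution

namespace LinearResolution

variable {K B σ : Type} [Field K] [CommRing B] [Algebra K B] {ℬ : ℤ × ℤ → Submodule K B}
  {deg : σ → ℤ × ℤ} {m : σ → σ →₀ B} {o : σ}

theorem deg_of_entry_ne_zero (h : LinearResolution ℬ deg m o) {n : ℕ} {i l : σ}
    (hi : deg i = (((n + 1 : ℕ) : ℤ), 0)) (hil : m i l ≠ 0) : deg l = ((n : ℤ), 0) := by
  have h1 := h.entry_total i l hil
  have h2 := h.snd_nonneg l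
  have h3 : ¬ (deg i - deg l).2 < 0 := by
    intro hlt
    have := h.entry_mem i l
    rw [h.eq_bot _ (Or.inr hlt)] at this
    exact hil ((Submodule.mem_bot K).mp this)
  rw [hi] at h1 h3
  simp only [totalDegree, Prod.snd_sub] at h1 h3
  push_cast at h1
  refine Prod.ext ?_ ?_ <;> simp only <;> omega

theorem entry_eq_zero (h : LinearResolution ℬ deg m o) {i l : σ}
    (hi : totalDegree (deg i) = 0) : m i l = 0 := by
  by_contra hil
  have h1 := h.entry_total i l hil
  have h2 := h.snd_nonneg l
  have h3 := h.fst_nonneg l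
  simp only [totalDegree] at h1 h2 h3 hi
  omega

theorem matrixAct_matrixAct (h : LinearResolution ℬ deg m o) (x : σ →₀ σ →₀ B) :
    matrixAct m (matrixAct m x) = 0 :=
  column_ext fun i => by rw [column_matrixAct, column_matrixAct, h.sq_zero, map_zero]

theorem rightAct_rightAct (h : LinearResolution ℬ deg m o) (x : σ →₀ σ →₀ B) :
    rightAct m (rightAct m x) = 0 :=
  Finsupp.ext fun i => by rw [rightAct_apply, rightAct_apply, h.sq_zero]; rfl

theorem lin_step (h : LinearResolution ℬ deg m o) (n : ℕ) (i l : σ)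
    (hi : deg i = (((n + 1 : ℕ) : ℤ), 0)) (hil : m i l ≠ 0) : deg l = ((n : ℤ), 0) :=
  h.deg_of_entry_ne_zero hi hil

theorem total_step (h : LinearResolution ℬ deg m o) (n : ℕ) (i l : σ)
    (hi : totalDegree (deg i) = (n + 1 : ℕ)) (hil : m i l ≠ 0) : totalDegree (deg l) = n := by
  have := h.entry_total i l hil
  push_cast at hi
  omega

theorem lin_zero_step (h : LinearResolution ℬ deg m o) (i l : σ)
    (hi : deg i = (((0 : ℕ) : ℤ), 0)) (hil : m i l ≠ 0) : False :=
  hil (h.entry_eq_zero (by rw [hi]; simp [totalDegree]))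

theorem total_of_lin {n : ℕ} {p : ℤ × ℤ} (hp : p = ((n : ℤ), 0)) : totalDegree p = n := by
  rw [hp]; simp [totalDegree]

theorem mem_lin_of_snd_eq_zero (h : LinearResolution ℬ deg m o) {n : ℕ} {κ : ℤ × ℤ}
    (hκ : κ.2 ≤ 0) {x : σ →₀ B}
    (hx : x ∈ supportedPart ℬ deg (fun i => totalDegree (deg i) = n) κ) :
    x ∈ supportedPart ℬ deg (fun i => deg i = ((n : ℤ), 0)) κ := by
  refine fun i => ⟨(hx i).1, fun hi => ?_⟩
  by_cases hn : totalDegree (deg i) = n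
  · have h2 := h.snd_nonneg i
    have h3 : (deg i).2 ≠ 0 := by
      intro h0
      refine hi (Prod.ext ?_ h0)
      simp only [totalDegree] at hn ⊢
      omega
    have := (hx i).1
    rw [h.eq_bot _ (Or.inr (by simp only [Prod.snd_sub]; omega))] at this
    exact (Submodule.mem_bot K).mp this
  · exact (hx i).2 hn

theorem row_exact (h : LinearResolution ℬ deg m o) (S : σ → Prop) (s : ℕ) (κ : ℤ × ℤ)
    (hS : ∀ i, S i → κ - deg i ≠ 0) {x : σ →₀ σ →₀ B}
    (hx : x ∈ supportedPart₂ ℬ deg S (fun i => totalDegree (deg i) = s) κ)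
    (hx0 : rightAct m x = 0) :
    ∃ w ∈ supportedPart₂ ℬ deg S (fun i => totalDegree (deg i) = (s + 1 : ℕ)) κ,
      rightAct m w = x := by
  have key : ∀ i, ∃ w ∈ supportedPart ℬ deg (fun i => totalDegree (deg i) = (s + 1 : ℕ))
      (κ - deg i), matrixAct m w = x i ∧ (x i = 0 → w = 0) := by
    intro i
    by_cases hi : x i = 0
    · exact ⟨0, zero_mem _, by rw [map_zero, hi], fun _ => rfl⟩
    · have hSi : S i := by
        by_contra hn
        exact hi ((hx i).2 hn)
      obtain ⟨w, hw, hwx⟩ := h.exact s (κ - deg i) (x i) (hx i).1 (DFunLike.congr_fun hx0 i)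
        (Or.inl (hS i hSi))
      exact ⟨w, hw, hwx, fun h0 => absurd h0 hi⟩
  choose w hw hwx hw0 using key
  refine ⟨Finsupp.onFinset x.support w fun i hi => ?_, fun i => ⟨hw i, fun hi => ?_⟩, ?_⟩
  · exact Finsupp.mem_support_iff.mpr fun h0 => hi (hw0 i h0)
  · exact hw0 i ((hx i).2 hi)
  · exact Finsupp.ext fun i => hwx i

/-- Exactness, in degrees `(k, j)` with `k` bigger than the homological degree, of the part
of the resolution spanned by the basis elements of degrees `(n, 0)`. -/
def StripExact (ℬ : ℤ × ℤ → Submodule K B) (deg : σ → ℤ × ℤ) (m : σ → σ →₀ B) (j : ℤ) : Prop :=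
  ∀ (n : ℕ) (k : ℤ) (x : σ →₀ B), (n : ℤ) < k →
    x ∈ supportedPart ℬ deg (fun i => deg i = ((n : ℤ), 0)) (k, j) → matrixAct m x = 0 →
    ∃ w ∈ supportedPart ℬ deg (fun i => deg i = (((n + 1 : ℕ) : ℤ), 0)) (k, j), matrixAct m w = x

theorem stripExact_of_nonpos (h : LinearResolution ℬ deg m o) {j : ℤ} (hj : j ≤ 0) :
    StripExact ℬ deg m j := by
  intro n k x hk hx hx0
  obtain ⟨w, hw, hwx⟩ := h.exact n (k, j) x (supportedPart_mono (fun i hi => total_of_lin hi) hx)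
    hx0 (Or.inl fun h0 => by
      have := congrArg Prod.fst h0
      simp only [Prod.fst_zero] at this
      omega)
  exact ⟨w, h.mem_lin_of_snd_eq_zero hj hw, hwx⟩

theorem column_exact [GradedAlgebra ℬ] (h : LinearResolution ℬ deg m o) {j : ℤ}
    (ih : ∀ j' < j, StripExact ℬ deg m j') (p s : ℕ) (k : ℤ) (hk : (p : ℤ) + s ≤ k)
    {x : σ →₀ σ →₀ B}
    (hx : x ∈ supportedPart₂ ℬ deg (fun i => deg i = ((p : ℤ), 0))
      (fun i => totalDegree (deg i) = s) (k, j))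
    (hx0 : ∀ i, (deg i).2 ≠ 0 → matrixAct m (column i x) = 0) :
    ∃ y ∈ supportedPart₂ ℬ deg (fun i => deg i = (((p + 1 : ℕ) : ℤ), 0))
      (fun i => totalDegree (deg i) = s) (k, j),
      x - matrixAct m y ∈ supportedPart₂ ℬ deg (fun i => deg i = ((p : ℤ), 0))
        (fun i => deg i = ((s : ℤ), 0)) (k, j) := by
  have key : ∀ i, ∃ c ∈ supportedPart ℬ deg (fun i => deg i = (((p + 1 : ℕ) : ℤ), 0))
      ((k, j) - deg i), ((deg i).2 ≠ 0 → matrixAct m c = column i x) ∧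
      (column i x = 0 ∨ (deg i).2 = 0 → c = 0) := by
    intro i
    by_cases hi : column i x = 0 ∨ (deg i).2 = 0
    · refine ⟨0, zero_mem _, fun h2 => ?_, fun _ => rfl⟩
      rw [map_zero, hi.resolve_right h2]
    · push Not at hi
      have hs : totalDegree (deg i) = s := by
        by_contra hn
        exact hi.1 (Finsupp.ext fun l => ((hx l).1 i).2 hn)
      have h2 := h.snd_nonneg i
      have h2' := hi.2
      simp only [totalDegree] at hs
      obtain ⟨c, hc, hcx⟩ := ih (j - (deg i).2) (by omega) p (k - (deg i).1) (column i x)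
        (by omega) (column_mem hx i) (hx0 i hi.2)
      exact ⟨c, hc, fun _ => hcx, fun h0 => absurd h0 (by push Not; exact hi)⟩
  choose c hc hcx hc0 using key
  obtain ⟨t, ht⟩ := exists_finset_column x
  obtain ⟨y, hy⟩ := exists_column_eq c t fun i hi => hc0 i (Or.inl (ht i hi))
  have hymem : y ∈ supportedPart₂ ℬ deg (fun i => deg i = (((p + 1 : ℕ) : ℤ), 0))
      (fun i => totalDegree (deg i) = s) (k, j) := by
    refine mem_supportedPart₂_of_column (fun i => by rw [hy]; exact hc i) fun i hi => ?_
    rw [hy]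
    exact hc0 i (Or.inl (Finsupp.ext fun l => ((hx l).1 i).2 hi))
  have hxy := Submodule.sub_mem _ hx (matrixAct_mem₂ h.entry_mem (h.lin_step p) hymem)
  refine ⟨y, hymem, mem_supportedPart₂_of_column (column_mem hxy) fun i hi => ?_⟩
  by_cases hs : totalDegree (deg i) = s
  · have h2 : (deg i).2 ≠ 0 := by
      intro h0
      refine hi (Prod.ext ?_ h0)
      simp only [totalDegree] at hs ⊢
      omega
    rw [column_sub, column_matrixAct, hy, hcx i h2, sub_self]
  · exact Finsupp.ext fun l => ((hxy l).1 i).2 hs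

/-- A multiplication on the linear part of the resolution, lifting the multiplication of the
residue field, in homological degrees up to `N`. -/
structure IsMultiplication (ℬ : ℤ × ℤ → Submodule K B) (deg : σ → ℤ × ℤ) (m : σ → σ →₀ B) (o : σ)
    (N : ℕ) (ρ : σ → σ → σ →₀ B) : Prop where
  mul_base : ∀ i, ρ i o = Finsupp.single i 1
  mem : ∀ p q : ℕ, p + q ≤ N → ∀ i j, deg i = ((p : ℤ), 0) → deg j = ((q : ℤ), 0) →
    ρ i j ∈ supportedPart ℬ deg (fun i => deg i = (((p + q : ℕ) : ℤ), 0)) (deg i + deg j)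
  leibniz : ∀ p q : ℕ, p + q ≤ N → ∀ i j, deg i = ((p : ℤ), 0) → deg j = ((q : ℤ), 0) →
    matrixAct m (ρ i j) =
      pairing ρ (matrixAct m (Finsupp.single i (Finsupp.single j 1))) +
        (-1 : ℤ) ^ p • pairing ρ (rightAct m (Finsupp.single i (Finsupp.single j 1)))

theorem leibniz_of_mem {N : ℕ} {ρ : σ → σ → σ →₀ B} (hρ : IsMultiplication ℬ deg m o N ρ)
    {p q : ℕ} (hpq : p + q ≤ N) {κ : ℤ × ℤ} {x : σ →₀ σ →₀ B}
    (hx : x ∈ supportedPart₂ ℬ deg (fun i => deg i = ((p : ℤ), 0))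
      (fun i => deg i = ((q : ℤ), 0)) κ) :
    matrixAct m (pairing ρ x) =
      pairing ρ (matrixAct m x) + (-1 : ℤ) ^ p • pairing ρ (rightAct m x) := by
  refine eq_of_eq_on_support (matrixAct m ∘ₗ pairing ρ)
    (pairing ρ ∘ₗ matrixAct m + (-1 : ℤ) ^ p • (pairing ρ ∘ₗ rightAct m)) x fun i j hij => ?_
  have hi : deg i = ((p : ℤ), 0) := by
    by_contra hn
    exact hij (by rw [(hx i).2 hn]; rfl)
  have hj : deg j = ((q : ℤ), 0) := by
    by_contra hn
    exact hij (((hx i).1 j).2 hn)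
  simp only [LinearMap.comp_apply, LinearMap.add_apply, LinearMap.smul_apply, pairing_single]
  exact hρ.leibniz p q hpq i j hi hj

theorem pairing_mem_lin [GradedAlgebra ℬ] {N : ℕ} {ρ : σ → σ → σ →₀ B}
    (hρ : IsMultiplication ℬ deg m o N ρ)
    {p q : ℕ} (hpq : p + q ≤ N) {κ : ℤ × ℤ} {x : σ →₀ σ →₀ B}
    (hx : x ∈ supportedPart₂ ℬ deg (fun i => deg i = ((p : ℤ), 0))
      (fun i => deg i = ((q : ℤ), 0)) κ) :
    pairing ρ x ∈ supportedPart ℬ deg (fun i => deg i = (((p + q : ℕ) : ℤ), 0)) κ :=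
  pairing_mem (fun i j hi hj => hρ.mem p q hpq i j hi hj) hx

theorem rightAct_single (m : σ → σ →₀ B) (i j : σ) :
    rightAct m (Finsupp.single i (Finsupp.single j 1)) = Finsupp.single i (m j) := by
  rw [rightAct, Finsupp.mapRange.linearMap_apply, Finsupp.mapRange_single]
  congr 1
  ext l
  rw [matrixAct_single, smul_eq_mul, mul_one]

theorem leibniz_base (h : LinearResolution ℬ deg m o) {ρ : σ → σ → σ →₀ B}
    (hρ : ∀ i, ρ i o = Finsupp.single i 1) (p : ℕ) (i : σ) :
    matrixAct m (ρ i o) =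
      pairing ρ (matrixAct m (Finsupp.single i (Finsupp.single o 1))) +
        (-1 : ℤ) ^ p • pairing ρ (rightAct m (Finsupp.single i (Finsupp.single o 1))) := by
  have h0 : m o = 0 := Finsupp.ext fun l =>
    h.entry_eq_zero (by rw [h.deg_base]; rfl)
  rw [rightAct_single, h0, Finsupp.single_zero, map_zero, smul_zero, add_zero, hρ]
  have h1 : matrixAct m (Finsupp.single i (1 : B)) = m i := by
    ext l
    rw [matrixAct_single, smul_eq_mul, mul_one]
  have h2 : matrixAct m (Finsupp.single i (Finsupp.single o (1 : B))) =
      Finsupp.mapRange.linearMap (Finsupp.lsingle (R := B) o) (m i) := by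
    refine Finsupp.ext fun l => ?_
    rw [matrixAct_single, Finsupp.mapRange.linearMap_apply, Finsupp.mapRange_apply,
      Finsupp.lsingle_apply, Finsupp.smul_single, smul_eq_mul, mul_one]
  rw [h1, h2]
  suffices (pairing ρ) ∘ₗ Finsupp.mapRange.linearMap (Finsupp.lsingle (R := B) o) =
      LinearMap.id from (DFunLike.congr_fun this (m i)).symm
  refine Finsupp.lhom_ext' fun l => LinearMap.ext_ring ?_
  simp only [LinearMap.comp_apply, Finsupp.lsingle_apply, LinearMap.id_apply,
    Finsupp.mapRange.linearMap_apply, Finsupp.mapRange_single, pairing_single, hρ]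

end LinearResolution

namespace LinearResolution

variable {K B σ : Type} [Field K] [CommRing B] [Algebra K B] {ℬ : ℤ × ℤ → Submodule K B}
  {deg : σ → ℤ × ℤ} {m : σ → σ →₀ B} {o : σ}

theorem of_apply_ne_zero {S T : σ → Prop} {κ : ℤ × ℤ} {x : σ →₀ σ →₀ B}
    (hx : x ∈ supportedPart₂ ℬ deg S T κ) {i j : σ} (hij : x i j ≠ 0) : S i ∧ T j := by
  constructor
  · by_contra hn
    exact hij (by rw [(hx i).2 hn]; rfl)
  · by_contra hn
    exact hij (((hx i).1 j).2 hn)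

theorem matrixAct_eq_zero_of_lin_zero [GradedAlgebra ℬ] (h : LinearResolution ℬ deg m o)
    {T : σ → Prop} {κ : ℤ × ℤ} {x : σ →₀ σ →₀ B}
    (hx : x ∈ supportedPart₂ ℬ deg (fun i => deg i = (((0 : ℕ) : ℤ), 0)) T κ) :
    matrixAct m x = 0 :=
  eq_zero_of_mem_supportedPart₂ (Or.inl fun _ => not_false)
    (matrixAct_mem₂ (S' := fun _ => False) h.entry_mem h.lin_zero_step hx)

theorem leibniz_rhs [GradedAlgebra ℬ] (h : LinearResolution ℬ deg m o) {N : ℕ}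
    {ρ : σ → σ → σ →₀ B} (hρ : IsMultiplication ℬ deg m o N ρ) {p q : ℕ} (hpq : p + q ≤ N)
    {κ : ℤ × ℤ} {x : σ →₀ σ →₀ B}
    (hx : x ∈ supportedPart₂ ℬ deg (fun i => deg i = ((p : ℤ), 0))
      (fun i => deg i = (((q + 1 : ℕ) : ℤ), 0)) κ) :
    pairing ρ (matrixAct m x) + (-1 : ℤ) ^ p • pairing ρ (rightAct m x) ∈
      supportedPart ℬ deg (fun i => deg i = (((p + q : ℕ) : ℤ), 0)) κ ∧
    matrixAct m (pairing ρ (matrixAct m x) + (-1 : ℤ) ^ p • pairing ρ (rightAct m x)) = 0 := by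
  have hhx := rightAct_mem₂ (T' := fun i => deg i = ((q : ℤ), 0)) h.entry_mem (h.lin_step q) hx
  have hhm := pairing_mem_lin hρ hpq hhx
  have hhl := leibniz_of_mem hρ hpq hhx
  rw [h.rightAct_rightAct, map_zero, smul_zero, add_zero, ← rightAct_matrixAct] at hhl
  have hsm : (-1 : ℤ) ^ p • pairing ρ (rightAct m x) ∈
      supportedPart ℬ deg (fun i => deg i = (((p + q : ℕ) : ℤ), 0)) κ :=
    zsmul_mem hhm _
  cases p with
  | zero =>
    have hv := h.matrixAct_eq_zero_of_lin_zero hx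
    rw [hv, map_zero, map_zero] at hhl
    rw [hv, map_zero]
    refine ⟨add_mem (zero_mem _) hsm, ?_⟩
    rw [map_add, map_zero, zero_add, map_zsmul, hhl, smul_zero]
  | succ p =>
    have hvx := matrixAct_mem₂ (S' := fun i => deg i = ((p : ℤ), 0)) h.entry_mem (h.lin_step p) hx
    have hvm := pairing_mem_lin hρ (by omega) hvx
    have hvl := leibniz_of_mem hρ (by omega) hvx
    rw [h.matrixAct_matrixAct, map_zero, zero_add] at hvl
    refine ⟨add_mem ?_ hsm, ?_⟩
    · rwa [show p + 1 + q = p + (q + 1) by omega]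
    · rw [map_add, map_zsmul, hhl, hvl, pow_succ, mul_neg_one, neg_smul, add_neg_cancel]

theorem IsMultiplication.exists_succ [GradedAlgebra ℬ] (h : LinearResolution ℬ deg m o) {N : ℕ}
    {ρ : σ → σ → σ →₀ B} (hρ : IsMultiplication ℬ deg m o N ρ) :
    ∃ ρ', IsMultiplication ℬ deg m o (N + 1) ρ' := by
  classical
  have hsingle : ∀ {p q : ℕ} {i j : σ}, deg i = ((p : ℤ), 0) → deg j = ((q : ℤ), 0) →
      Finsupp.single i (Finsupp.single j (1 : B)) ∈ supportedPart₂ ℬ deg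
        (fun i => deg i = ((p : ℤ), 0)) (fun i => deg i = ((q : ℤ), 0)) (deg i + deg j) := by
    intro p q i j hi hj l
    rw [Finsupp.single_apply]
    split_ifs with hl
    · subst hl
      refine ⟨single_mem_supportedPart (S := fun i => deg i = ((q : ℤ), 0)) hj ?_, fun hn => absurd hi hn⟩
      rw [add_sub_cancel_left, sub_self]
      exact SetLike.one_mem_graded ℬ
    · exact ⟨zero_mem _, fun _ => rfl⟩
  have key : ∀ i j, ∃ g : σ →₀ B, (j ≠ o → ∀ p q : ℕ, deg i = ((p : ℤ), 0) →
      deg j = ((q : ℤ), 0) → p + q = N + 1 →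
      g ∈ supportedPart ℬ deg (fun i => deg i = (((p + q : ℕ) : ℤ), 0)) (deg i + deg j) ∧
      matrixAct m g = pairing ρ (matrixAct m (Finsupp.single i (Finsupp.single j 1))) +
        (-1 : ℤ) ^ p • pairing ρ (rightAct m (Finsupp.single i (Finsupp.single j 1)))) ∧
      ((j = o ∨ ∀ p q : ℕ, deg i = ((p : ℤ), 0) → deg j = ((q : ℤ), 0) → p + q ≠ N + 1) →
        g = ρ i j) := by
    intro i j
    by_cases hc : j = o ∨ ∀ p q : ℕ, deg i = ((p : ℤ), 0) → deg j = ((q : ℤ), 0) → p + q ≠ N + 1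
    · refine ⟨ρ i j, fun hj p q hp hq hpq => ?_, fun _ => rfl⟩
      rcases hc with hc | hc
      · exact absurd hc hj
      · exact absurd hpq (hc p q hp hq)
    · have hc' := hc
      push Not at hc
      obtain ⟨hj, p, q, hp, hq, hpq⟩ := hc
      obtain _ | q := q
      · exact absurd (h.eq_base j (by rw [hq]; rfl)) hj
      obtain ⟨hmem, hcyc⟩ := h.leibniz_rhs hρ (p := p) (q := q) (by omega) (hsingle hp hq)
      obtain ⟨g, hg, hgx⟩ := h.exact (p + q) _ _
        (supportedPart_mono (fun i hi => total_of_lin hi) hmem) hcyc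
        (Or.inl fun h0 => by
          rw [hp, hq] at h0
          have := congrArg Prod.fst h0
          simp only [Prod.fst_add, Prod.fst_zero] at this
          omega)
      have hg' := h.mem_lin_of_snd_eq_zero (by rw [hp, hq]; simp) hg
      refine ⟨g, fun _ p' q' hp' hq' hpq' => ?_, fun hn => absurd hn hc'⟩
      have hpp : p' = p := by
        have := congrArg Prod.fst (hp.symm.trans hp')
        simp only at this
        omega
      subst hpp
      rw [hpq', ← hpq]
      exact ⟨hg', hgx⟩
  choose ρ' hρ' hρ'eq using key
  have hbase : ∀ i, ρ' i o = Finsupp.single i 1 := fun i => by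
    rw [hρ'eq i o (Or.inl rfl), hρ.mul_base]
  have hlow : ∀ (p q : ℕ) (i j : σ), p + q ≤ N → deg i = ((p : ℤ), 0) → deg j = ((q : ℤ), 0) →
      ρ' i j = ρ i j := by
    intro p q i j hpq hi hj
    refine hρ'eq i j (Or.inr fun p' q' hp' hq' hpq' => ?_)
    have h1 := congrArg Prod.fst (hi.symm.trans hp')
    have h2 := congrArg Prod.fst (hj.symm.trans hq')
    simp only at h1 h2
    omega
  have hcongr : ∀ {p q : ℕ} {i j : σ}, p + q ≤ N + 1 → deg i = ((p : ℤ), 0) →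
      deg j = ((q : ℤ), 0) →
      pairing ρ' (matrixAct m (Finsupp.single i (Finsupp.single j 1))) +
        (-1 : ℤ) ^ p • pairing ρ' (rightAct m (Finsupp.single i (Finsupp.single j 1))) =
      pairing ρ (matrixAct m (Finsupp.single i (Finsupp.single j 1))) +
        (-1 : ℤ) ^ p • pairing ρ (rightAct m (Finsupp.single i (Finsupp.single j 1))) := by
    intro p q i j hpq hi hj
    congr 1
    · refine pairing_congr _ _ _ fun i' j' hij => ?_
      rcases p with _ | p
      · rw [h.matrixAct_eq_zero_of_lin_zero (hsingle hi hj)] at hij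
        exact absurd rfl hij
      · have := of_apply_ne_zero (matrixAct_mem₂ (S' := fun i => deg i = ((p : ℤ), 0))
          h.entry_mem (h.lin_step p) (hsingle hi hj)) hij
        exact hlow p q i' j' (by omega) this.1 this.2
    · congr 1
      refine pairing_congr _ _ _ fun i' j' hij => ?_
      rcases q with _ | q
      · have := of_apply_ne_zero (rightAct_mem₂ (T' := fun _ => False)
          h.entry_mem h.lin_zero_step (hsingle hi hj)) hij
        exact absurd this.2 not_false
      · have := of_apply_ne_zero (rightAct_mem₂ (T' := fun i => deg i = ((q : ℤ), 0))
          h.entry_mem (h.lin_step q) (hsingle hi hj)) hij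
        exact hlow p q i' j' (by omega) this.1 this.2
  refine ⟨ρ', hbase, fun p q hpq i j hi hj => ?_, fun p q hpq i j hi hj => ?_⟩
  · by_cases hjo : j = o
    · subst hjo
      have hq : q = 0 := by
        have := congrArg Prod.fst (hj.symm.trans h.deg_base)
        simp only [Prod.fst_zero] at this
        omega
      rw [hbase, h.deg_base, add_zero, hq, add_zero]
      refine single_mem_supportedPart (S := fun i => deg i = ((p : ℤ), 0)) hi ?_
      rw [sub_self]
      exact SetLike.one_mem_graded ℬ
    · by_cases hN : p + q = N + 1
      · exact (hρ' i j hjo p q hi hj hN).1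
      · rw [hlow p q i j (by omega) hi hj]
        exact hρ.mem p q (by omega) i j hi hj
  · by_cases hjo : j = o
    · subst hjo
      exact h.leibniz_base hbase p i
    · rw [hcongr hpq hi hj]
      by_cases hN : p + q = N + 1
      · exact (hρ' i j hjo p q hi hj hN).2
      · rw [hlow p q i j (by omega) hi hj]
        exact hρ.leibniz p q (by omega) i j hi hj

theorem exists_isMultiplication [GradedAlgebra ℬ] (h : LinearResolution ℬ deg m o) (N : ℕ) :
    ∃ ρ, IsMultiplication ℬ deg m o N ρ := by
  induction N with
  | zero =>
    have hbase : ∀ {q : ℕ} {j : σ}, q = 0 → deg j = ((q : ℤ), 0) → j = o := by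
      rintro q j rfl hj
      exact h.eq_base j (by rw [hj]; rfl)
    refine ⟨fun i _ => Finsupp.single i 1, fun _ => rfl, fun p q hpq i j hi hj => ?_,
      fun p q hpq i j hi hj => ?_⟩
    · obtain rfl := hbase (by omega) hj
      have hq : q = 0 := by omega
      rw [h.deg_base, add_zero, hq, add_zero]
      refine single_mem_supportedPart (S := fun i => deg i = ((p : ℤ), 0)) hi ?_
      rw [sub_self]
      exact SetLike.one_mem_graded ℬ
    · obtain rfl := hbase (by omega) hj
      exact h.leibniz_base (ρ := fun i _ => Finsupp.single i 1) (fun _ => rfl) p i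
  | succ N ih =>
    obtain ⟨ρ, hρ⟩ := ih
    exact hρ.exists_succ h

end LinearResolution

namespace LinearResolution

variable {K B σ : Type} [Field K] [CommRing B] [Algebra K B] {ℬ : ℤ × ℤ → Submodule K B}
  {deg : σ → ℤ × ℤ} {m : σ → σ →₀ B} {o : σ}

theorem exists_decomposition_step [GradedAlgebra ℬ] (h : LinearResolution ℬ deg m o) {j : ℤ}
    (ih : ∀ j' < j, StripExact ℬ deg m j') {N : ℕ} {ρ : σ → σ → σ →₀ B}
    (hρ : IsMultiplication ℬ deg m o N ρ) (k : ℤ) (p : ℕ) (s : ℕ)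
    (hk : (p : ℤ) + s < k) (hN : p + s + 1 ≤ N) {x w y' e : σ →₀ σ →₀ B} {g' : σ →₀ B}
    (hwx : rightAct m w = x)
    (hw : w ∈ supportedPart₂ ℬ deg (fun i => deg i = ((p : ℤ), 0))
      (fun i => totalDegree (deg i) = (s + 1 : ℕ)) (k, j))
    (hy' : y' ∈ supportedPart₂ ℬ deg (fun i => deg i = ((p : ℤ), 0))
      (fun i => totalDegree (deg i) = (s + 1 : ℕ)) (k, j))
    (hg' : g' ∈ supportedPart ℬ deg (fun i => deg i = (((p + s + 1 : ℕ) : ℤ), 0)) (k, j))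
    (hhy' : rightAct m y' = 0) (he : ∀ i, (deg i).2 ≠ 0 → column i e = 0)
    (hvw : matrixAct m w = matrixAct m y' + e) (hge : matrixAct m g' = pairing ρ e) :
      ∃ y ∈ supportedPart₂ ℬ deg (fun i => deg i = (((p + 1 : ℕ) : ℤ), 0))
        (fun i => totalDegree (deg i) = s) (k, j),
      ∃ u ∈ supportedPart₂ ℬ deg (fun i => deg i = ((p : ℤ), 0))
        (fun i => deg i = (((s + 1 : ℕ) : ℤ), 0)) (k, j),
      ∃ g ∈ supportedPart ℬ deg (fun i => deg i = (((p + s + 1 : ℕ) : ℤ), 0)) (k, j),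
        rightAct m y = 0 ∧ x = matrixAct m y + rightAct m u ∧
        matrixAct m g = pairing ρ (rightAct m u) := by
  have hvw' : matrixAct m (w - y') = e := by
    rw [map_sub (matrixAct m), hvw, add_sub_cancel_left]
  have hwy : w - y' ∈ supportedPart₂ ℬ deg (fun i => deg i = ((p : ℤ), 0))
      (fun i => totalDegree (deg i) = (s + 1 : ℕ)) (k, j) :=
    supportedPart₂_sub_mem hw hy'
  obtain ⟨y, hy, hu⟩ := h.column_exact ih p (s + 1) k (by push_cast; omega) hwy fun i hi => by rw [← column_matrixAct, hvw', he i hi]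
  have hhu : x = matrixAct m (rightAct m y) + rightAct m (w - y' - matrixAct m y) := by
    have hsub : ∀ {G : Type} [AddCommGroup G] (a b : G), b = a + (b - 0 - a) :=
      fun a b => by rw [sub_zero, add_sub_cancel]
    rw [map_sub (rightAct m), map_sub (rightAct m), hhy', hwx, rightAct_matrixAct]
    exact hsub (G := σ →₀ σ →₀ B) _ _
  have hvu : matrixAct m (w - y' - matrixAct m y) = e := by
    rw [map_sub (matrixAct m), hvw', h.matrixAct_matrixAct, sub_zero]
  generalize w - y' - matrixAct m y = u at hu hhu hvu
  have hl := leibniz_of_mem hρ (by omega) hu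
  rw [hvu, ← hge] at hl
  refine ⟨rightAct m y, rightAct_mem₂ h.entry_mem (h.total_step s) hy, u, hu,
    (-1 : ℤ) ^ p • (pairing ρ u - g'),
    zsmul_mem (Submodule.sub_mem _ (pairing_mem_lin hρ (by omega) hu) hg') _,
    h.rightAct_rightAct y, hhu, ?_⟩
  rw [map_zsmul, map_sub (matrixAct m), hl, add_sub_cancel_left, smul_smul, ← mul_pow,
    neg_one_mul, neg_neg, one_pow, one_smul]

theorem exists_decomposition [GradedAlgebra ℬ] (h : LinearResolution ℬ deg m o) {j : ℤ}
    (hj : 1 ≤ j) (ih : ∀ j' < j, StripExact ℬ deg m j') {N : ℕ} {ρ : σ → σ → σ →₀ B}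
    (hρ : IsMultiplication ℬ deg m o N ρ) (k : ℤ) (p : ℕ) :
    ∀ s : ℕ, (p : ℤ) + s < k → p + s + 1 ≤ N → ∀ x ∈ supportedPart₂ ℬ deg
      (fun i => deg i = ((p : ℤ), 0)) (fun i => totalDegree (deg i) = s) (k, j),
      matrixAct m x = 0 → rightAct m x = 0 →
      ∃ y ∈ supportedPart₂ ℬ deg (fun i => deg i = (((p + 1 : ℕ) : ℤ), 0))
        (fun i => totalDegree (deg i) = s) (k, j),
      ∃ u ∈ supportedPart₂ ℬ deg (fun i => deg i = ((p : ℤ), 0))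
        (fun i => deg i = (((s + 1 : ℕ) : ℤ), 0)) (k, j),
      ∃ g ∈ supportedPart ℬ deg (fun i => deg i = (((p + s + 1 : ℕ) : ℤ), 0)) (k, j),
        rightAct m y = 0 ∧ x = matrixAct m y + rightAct m u ∧
        matrixAct m g = pairing ρ (rightAct m u) := by
  have row : ∀ p s : ℕ, ∀ x ∈ supportedPart₂ ℬ deg (fun i => deg i = ((p : ℤ), 0))
      (fun i => totalDegree (deg i) = s) (k, j), rightAct m x = 0 →
      ∃ w ∈ supportedPart₂ ℬ deg (fun i => deg i = ((p : ℤ), 0))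
        (fun i => totalDegree (deg i) = (s + 1 : ℕ)) (k, j), rightAct m w = x := by
    refine fun p s x hx hhx => h.row_exact _ s (k, j) (fun i hi h0 => ?_) hx hhx
    have := congrArg Prod.snd h0
    rw [hi] at this
    simp only [Prod.snd_sub, Prod.snd_zero] at this
    omega
  induction p with
  | zero =>
    intro s hk hN x hx hvx hhx
    obtain ⟨w, hw, hwx⟩ := row 0 s x hx hhx
    refine h.exists_decomposition_step ih hρ k 0 s hk hN hwx hw (zero_mem _) (zero_mem _)
      (map_zero _) (e := 0) (fun _ _ => map_zero _) ?_ ?_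
    · rw [h.matrixAct_eq_zero_of_lin_zero hw, map_zero, add_zero]
    · rw [map_zero, map_zero]
  | succ p ihp =>
    intro s hk hN x hx hvx hhx
    obtain ⟨w, hw, hwx⟩ := row (p + 1) s x hx hhx
    obtain ⟨y, hy, u, hu, g, hg, hhy, hvw, hgu⟩ := ihp (s + 1)
      (by push_cast at hk ⊢; omega) (by omega) (matrixAct m w)
      (matrixAct_mem₂ h.entry_mem (h.lin_step p) hw) (h.matrixAct_matrixAct w)
      (by rw [rightAct_matrixAct, hwx, hvx])
    refine h.exists_decomposition_step ih hρ k (p + 1) s hk hN hwx hw hy (g' := g)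
      (e := rightAct m u) ?_ hhy (fun i hi => ?_) hvw hgu
    · rwa [show p + 1 + s + 1 = p + (s + 1) + 1 by omega]
    · have := rightAct_mem₂ (T' := fun i => deg i = (((s + 1 : ℕ) : ℤ), 0)) h.entry_mem
        (h.lin_step (s + 1)) hu
      exact Finsupp.ext fun l => ((this l).1 i).2 fun h0 => hi (by rw [h0])

theorem stripExact_of_lt [GradedAlgebra ℬ] (h : LinearResolution ℬ deg m o) {j : ℤ} (hj : 1 ≤ j)
    (ih : ∀ j' < j, StripExact ℬ deg m j') : StripExact ℬ deg m j := by
  intro n k x hk hx hx0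
  obtain ⟨ρ, hρ⟩ := h.exists_isMultiplication (n + 1)
  have hm0 : m o = 0 := Finsupp.ext fun l => h.entry_eq_zero (by rw [h.deg_base]; rfl)
  have hρo : ∀ c : σ →₀ B,
      pairing ρ (Finsupp.mapRange.linearMap (Finsupp.lsingle (R := B) o) c) = c := by
    intro c
    suffices (pairing ρ) ∘ₗ Finsupp.mapRange.linearMap (Finsupp.lsingle (R := B) o) =
        LinearMap.id from DFunLike.congr_fun this c
    refine Finsupp.lhom_ext' fun l => LinearMap.ext_ring ?_
    simp only [LinearMap.comp_apply, Finsupp.lsingle_apply, LinearMap.id_apply,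
      Finsupp.mapRange.linearMap_apply, Finsupp.mapRange_single, pairing_single, hρ.mul_base]
  set z : σ →₀ σ →₀ B := Finsupp.mapRange.linearMap (Finsupp.lsingle (R := B) o) x with hz
  have hzi : ∀ i, z i = Finsupp.single o (x i) := fun i => rfl
  have hzmem : z ∈ supportedPart₂ ℬ deg (fun i => deg i = ((n : ℤ), 0))
      (fun i => totalDegree (deg i) = (0 : ℕ)) (k, j) := by
    intro i
    rw [hzi]
    refine ⟨single_mem_supportedPart (S := fun i => totalDegree (deg i) = (0 : ℕ))
      (by rw [h.deg_base]; rfl) ?_, fun hn => ?_⟩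
    · rw [h.deg_base, sub_zero]
      exact (hx i).1
    · rw [(hx i).2 hn, Finsupp.single_zero]
  have hhz : rightAct m z = 0 := by
    refine Finsupp.ext fun i => Finsupp.ext fun l => ?_
    rw [rightAct_apply, hzi, matrixAct_single, hm0]
    exact zero_smul _ _
  have hvz : matrixAct m z = 0 := by
    rw [hz, ← mapRange_linear_matrixAct, hx0, map_zero]
  obtain ⟨y, hy, u, hu, g, hg, hhy, hzy, hgu⟩ := h.exists_decomposition hj ih hρ k n 0
    (by push_cast; omega) (by omega) z hzmem hvz hhz
  have hyo : y = Finsupp.mapRange.linearMap (Finsupp.lsingle (R := B) o) (column o y) := by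
    refine Finsupp.ext fun i => Finsupp.ext fun l => ?_
    rw [Finsupp.mapRange.linearMap_apply, Finsupp.mapRange_apply, Finsupp.lsingle_apply,
      column_apply]
    by_cases hl : l = o
    · rw [hl, Finsupp.single_eq_same]
    · rw [Finsupp.single_eq_of_ne hl]
      exact ((hy i).1 l).2 fun h0 => hl (h.eq_base l (by rw [h0]; rfl))
  refine ⟨column o y + g, add_mem ?_ hg, ?_⟩
  · have := column_mem hy o
    rwa [h.deg_base, sub_zero] at this
  · rw [map_add, hgu]
    have h1 : pairing ρ z = pairing ρ (matrixAct m y) + pairing ρ (rightAct m u) := by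
      rw [hzy, map_add]
    rw [hz, hρo, hyo, ← mapRange_linear_matrixAct, hρo] at h1
    exact h1.symm

theorem stripExact [GradedAlgebra ℬ] (h : LinearResolution ℬ deg m o) (j : ℤ) :
    StripExact ℬ deg m j := by
  rcases le_or_gt j 0 with hj | hj
  · exact h.stripExact_of_nonpos hj
  · obtain ⟨n, rfl⟩ := Int.eq_ofNat_of_zero_le hj.le
    induction n using Nat.strong_induction_on with
    | _ n ih =>
      refine h.stripExact_of_lt hj fun j' hj' => ?_
      rcases le_or_gt j' 0 with h0 | h0
      · exact h.stripExact_of_nonpos h0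
      · obtain ⟨n', rfl⟩ := Int.eq_ofNat_of_zero_le h0.le
        exact ih n' (by omega) h0

end LinearResolution

section LinearModule

/-- Exactness, in internal degrees bigger than `r`, of the tensor product of the module `M` with a
linear complex of free modules, where the basis elements of homological degree `n` are those
satisfying `L n`. -/
def LinearExact {K A σ M : Type} [Field K] [CommRing A] [AddCommGroup M] [Module A M] [Module K M]
    (L : ℕ → σ → Prop) (m : σ → σ →₀ A) (ℳ : ℤ → Submodule K M) (r : ℤ) : Prop :=
  ∀ (n : ℕ) (e : ℤ) (f : σ →₀ M), r < e → (∀ i, f i ∈ ℳ e) → (∀ i, ¬ L n i → f i = 0) →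
    matrixAct m f = 0 →
    ∃ g : σ →₀ M, (∀ i, g i ∈ ℳ (e - 1)) ∧ (∀ i, ¬ L (n + 1) i → g i = 0) ∧ matrixAct m g = f

/-- The linear strand of a minimal free resolution of the residue field of a standard graded
algebra. -/
structure LinearComplex {K A σ : Type} [Field K] [CommRing A] [Algebra K A]
    (𝒜 : ℤ → Submodule K A) (L : ℕ → σ → Prop) (m : σ → σ →₀ A) (o : σ) : Prop where
  base : L 0 o
  base_zero : m o = 0
  entry_mem : ∀ n i l, L n i → m i l ∈ 𝒜 1
  step : ∀ n i l, L (n + 1) i → m i l ≠ 0 → L n l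
  sq_zero : ∀ {M : Type} [AddCommGroup M] [Module A M] (f : σ →₀ M),
    matrixAct m (matrixAct m f) = 0
  exact : LinearExact L m 𝒜 0

/-- A graded module generated in degree `r` whose tensor product with the given linear complex is
exact in internal degrees bigger than `r`. -/
structure IsLinearModule {K A σ M : Type} [Field K] [CommRing A] [Algebra K A] [AddCommGroup M]
    [Module A M] [Module K M] (𝒜 : ℤ → Submodule K A) (L : ℕ → σ → Prop) (m : σ → σ →₀ A)
    (ℳ : ℤ → Submodule K M) (r : ℤ) : Prop where
  smul_mem : ∀ i j, ∀ a ∈ 𝒜 i, ∀ x ∈ ℳ j, a • x ∈ ℳ (i + j)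
  exists_sum : ∀ x, ∃ (t : Finset ℤ) (f : ℤ → M), (∀ k, f k ∈ ℳ k) ∧ x = ∑ k ∈ t, f k
  eq_zero_of_sum : ∀ (t : Finset ℤ) (f : ℤ → M), (∀ k, f k ∈ ℳ k) → ∑ k ∈ t, f k = 0 →
    ∀ k ∈ t, f k = 0
  eq_bot : ∀ k < r, ℳ k = ⊥
  exact : LinearExact L m ℳ r

theorem exists_sum_of_graded {K A : Type} [Field K] [CommRing A] [Algebra K A]
    (𝒜 : ℤ → Submodule K A) [GradedAlgebra 𝒜] (x : A) :
    ∃ (t : Finset ℤ) (f : ℤ → A), (∀ k, f k ∈ 𝒜 k) ∧ x = ∑ k ∈ t, f k := by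
  classical
  exact ⟨_, fun k => DirectSum.decompose 𝒜 x k, fun k => SetLike.coe_mem _,
    (DirectSum.sum_support_decompose 𝒜 x).symm⟩

theorem eq_zero_of_sum_of_graded {K A : Type} [Field K] [CommRing A] [Algebra K A]
    (𝒜 : ℤ → Submodule K A) [GradedAlgebra 𝒜] (t : Finset ℤ) (f : ℤ → A) (hf : ∀ k, f k ∈ 𝒜 k)
    (h : ∑ k ∈ t, f k = 0) (k : ℤ) (hk : k ∈ t) : f k = 0 := by
  classical
  have h1 : ((DirectSum.decompose 𝒜 (∑ k ∈ t, f k)) k : A) = 0 := by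
    rw [h, DirectSum.decompose_zero]; rfl
  rw [DirectSum.decompose_sum, DFinsupp.finsetSum_apply, AddSubmonoidClass.coe_finsetSum,
    Finset.sum_eq_single k] at h1
  · rwa [DirectSum.decompose_of_mem_same 𝒜 (hf k)] at h1
  · intro l _ hl
    exact DirectSum.decompose_of_mem_ne 𝒜 (hf l) hl
  · exact fun hn => absurd hk hn

variable {K A σ τ : Type} [Field K] [CommRing A] [Algebra K A] {𝒜 : ℤ → Submodule K A}
  {L : ℕ → σ → Prop} {m : σ → σ →₀ A} {o : σ}

theorem exists_sum_freeGrading [GradedAlgebra 𝒜] (r : ℤ) (x : τ →₀ A) :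
    ∃ (t : Finset ℤ) (f : ℤ → τ →₀ A), (∀ k, f k ∈ freeGrading 𝒜 (fun _ => r) k) ∧
      x = ∑ k ∈ t, f k := by
  classical
  induction x using Finsupp.induction_linear with
  | zero => exact ⟨∅, 0, fun k => zero_mem _, rfl⟩
  | add x y hx hy =>
    obtain ⟨t, f, hf, rfl⟩ := hx
    obtain ⟨t', f', hf', rfl⟩ := hy
    refine ⟨t ∪ t', fun k => (if k ∈ t then f k else 0) + (if k ∈ t' then f' k else 0),
      fun k => add_mem ?_ ?_, ?_⟩
    · split_ifs
      exacts [hf k, zero_mem _]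
    · split_ifs
      exacts [hf' k, zero_mem _]
    · rw [Finset.sum_add_distrib, Finset.sum_ite_mem, Finset.sum_ite_mem,
        Finset.union_inter_cancel_left, Finset.union_inter_cancel_right]
  | single s a =>
    obtain ⟨t, f, hf, ha⟩ := exists_sum_of_graded 𝒜 a
    refine ⟨t.map (addRightEmbedding r), fun k => Finsupp.single s (f (k - r)), fun k l => ?_, ?_⟩
    · rw [Finsupp.single_apply]
      split_ifs
      exacts [hf _, zero_mem _]
    · rw [Finset.sum_map, ha, Finsupp.single_finsetSum]
      simp only [addRightEmbedding_apply, add_sub_cancel_right]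

theorem eq_zero_of_sum_freeGrading [GradedAlgebra 𝒜] (r : ℤ) (t : Finset ℤ) (f : ℤ → τ →₀ A)
    (hf : ∀ k, f k ∈ freeGrading 𝒜 (fun _ => r) k) (h : ∑ k ∈ t, f k = 0) (k : ℤ) (hk : k ∈ t) :
    f k = 0 := by
  ext s
  have h1 : ∑ l ∈ t.map (addRightEmbedding (-r)), f (l + r) s = 0 := by
    rw [Finset.sum_map]
    simp only [addRightEmbedding_apply, neg_add_cancel_right]
    rw [← Finsupp.finsetSum_apply, h]
    rfl
  have h2 := eq_zero_of_sum_of_graded 𝒜 _ (fun l => f (l + r) s) (fun l => by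
    have := hf (l + r) s
    rwa [add_sub_cancel_right] at this) h1 (k - r) (Finset.mem_map.mpr ⟨k, hk, rfl⟩)
  simp only [sub_add_cancel] at h2
  exact h2

/-- Exactness passes to free modules. -/
theorem LinearComplex.exact_free (h : LinearComplex 𝒜 L m o) (r : ℤ) :
    LinearExact L m (freeGrading 𝒜 (fun _ : τ => r)) r := by
  classical
  intro n e f he hf hL hf0
  have key : ∀ s : τ, ∃ c : σ →₀ A, (∀ i, c i ∈ 𝒜 (e - 1 - r)) ∧ (∀ i, ¬ L (n + 1) i → c i = 0) ∧
      matrixAct m c = column s f ∧ (column s f = 0 → c = 0) := by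
    intro s
    by_cases hs : column s f = 0
    · exact ⟨0, fun _ => zero_mem _, fun _ _ => rfl, by rw [hs, map_zero], fun _ => rfl⟩
    · obtain ⟨c, hc, hcL, hcf⟩ := h.exact n (e - r) (column s f) (by omega) (fun i => hf i s)
        (fun i hi => by rw [column_apply, hL i hi]; rfl)
        (by rw [← column_matrixAct, hf0, map_zero])
      refine ⟨c, fun i => ?_, hcL, hcf, fun h0 => absurd h0 hs⟩
      rw [sub_right_comm]
      exact hc i
  choose c hc hcL hcf hc0 using key
  obtain ⟨t, ht⟩ := exists_finset_column f
  obtain ⟨y, hy⟩ := exists_column_eq c t fun i hi => hc0 i (ht i hi)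
  have hyi : ∀ i s, y i s = c s i := fun i s => DFunLike.congr_fun (hy s) i
  refine ⟨y, fun i s => ?_, fun i hi => Finsupp.ext fun s => ?_, column_ext fun s => ?_⟩
  · rw [hyi]
    exact hc s i
  · rw [hyi]
    exact hcL s i hi
  · rw [column_matrixAct, hy, hcf]

variable {M : Type} [AddCommGroup M] [Module A M] [Module K M]
  {ℳ : ℤ → Submodule K M} {r : ℤ}

theorem IsLinearModule.matrixAct_mem (h : LinearComplex 𝒜 L m o)
    (hsmul : ∀ i j, ∀ a ∈ 𝒜 i, ∀ x ∈ ℳ j, a • x ∈ ℳ (i + j)) {n : ℕ} {e : ℤ}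
    {f : σ →₀ M} (hf : ∀ i, f i ∈ ℳ (e - 1)) (hL : ∀ i, ¬ L (n + 1) i → f i = 0) :
    (∀ i, matrixAct m f i ∈ ℳ e) ∧ ∀ i, ¬ L n i → matrixAct m f i = 0 := by
  constructor
  · intro l
    rw [matrixAct_apply]
    refine Submodule.sum_mem _ fun i hi => ?_
    have hLi : L (n + 1) i := by
      by_contra hn
      exact Finsupp.mem_support_iff.mp hi (hL i hn)
    have := hsmul 1 (e - 1) _ (h.entry_mem _ i l hLi) _ (hf i)
    rwa [add_sub_cancel] at this
  · intro l hl
    rw [matrixAct_apply]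
    refine Finset.sum_eq_zero fun i hi => ?_
    have hLi : L (n + 1) i := by
      by_contra hn
      exact Finsupp.mem_support_iff.mp hi (hL i hn)
    by_cases h0 : m i l = 0
    · rw [h0, zero_smul]
    · exact absurd (h.step n i l hLi h0) hl

theorem freeGrading_smul_mem [GradedAlgebra 𝒜] (r i j : ℤ) (a : A) (ha : a ∈ 𝒜 i) (x : τ →₀ A)
    (hx : x ∈ freeGrading 𝒜 (fun _ => r) j) : a • x ∈ freeGrading 𝒜 (fun _ => r) (i + j) := by
  intro s
  have := SetLike.mul_mem_graded ha (hx s)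
  rwa [← add_sub_assoc] at this

/-- The homogeneous elements of a module satisfying `IsLinearModule` can be lifted along a map
which is surjective in degree `r`. -/
theorem IsLinearModule.exists_lift [GradedAlgebra 𝒜] (h : LinearComplex 𝒜 L m o)
    (hM : IsLinearModule 𝒜 L m ℳ r) (ε : (τ →₀ A) →ₗ[A] M)
    (hr : ∀ x ∈ ℳ r, ∃ f ∈ freeGrading 𝒜 (fun _ : τ => r) r, ε f = x) (k : ℤ) :
    ∀ x ∈ ℳ k, ∃ f ∈ freeGrading 𝒜 (fun _ : τ => r) k, ε f = x := by
  classical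
  rcases lt_or_ge k r with hk | hk
  · intro x hx
    rw [hM.eq_bot k hk] at hx
    exact ⟨0, zero_mem _, by rw [map_zero, (Submodule.mem_bot K).mp hx]⟩
  · obtain ⟨n, hn⟩ := Int.eq_ofNat_of_zero_le (sub_nonneg.mpr hk)
    obtain rfl : k = r + n := by omega
    clear hk hn
    induction n with
    | zero => simpa using hr
    | succ n ih =>
      intro x hx
      obtain ⟨g, hg, hgL, hgx⟩ := hM.exact 0 (r + (n + 1 : ℕ)) (Finsupp.single o x)
        (by push_cast; omega) (fun i => by
          rw [Finsupp.single_apply]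
          split_ifs
          exacts [hx, zero_mem _])
        (fun i hi => Finsupp.single_eq_of_ne fun h0 => hi (h0 ▸ h.base))
        (Finsupp.ext fun l => by
          rw [matrixAct_single, h.base_zero]
          exact zero_smul _ _)
      have hg' : ∀ i, ∃ f ∈ freeGrading 𝒜 (fun _ : τ => r) (r + n), ε f = g i := fun i => by
        have := hg i
        rw [show r + ((n + 1 : ℕ) : ℤ) - 1 = r + n by push_cast; omega] at this
        exact ih _ this
      choose f hf hfg using hg'
      refine ⟨∑ i ∈ g.support, m i o • f i, Submodule.sum_mem _ fun i hi => ?_, ?_⟩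
      · have hLi : L (0 + 1) i := by
          by_contra hn
          exact Finsupp.mem_support_iff.mp hi (hgL i hn)
        have := freeGrading_smul_mem r 1 (r + n) _ (h.entry_mem _ i o hLi) _ (hf i)
        rwa [show 1 + (r + (n : ℤ)) = r + ((n + 1 : ℕ) : ℤ) by push_cast; omega] at this
      · rw [map_sum]
        simp only [map_smul, hfg]
        rw [← matrixAct_apply, hgx, Finsupp.single_eq_same]

/-- The grading induced on the kernel of a map out of a graded free module. -/
noncomputable def kerGrading (𝒜 : ℤ → Submodule K A) (r : ℤ) (N : Submodule A (τ →₀ A)) (k : ℤ) :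
    Submodule K N :=
  (freeGrading 𝒜 (fun _ : τ => r) k).comap (N.subtype.restrictScalars K)

theorem mem_kerGrading {r : ℤ} {N : Submodule A (τ →₀ A)} {k : ℤ} {x : N} :
    x ∈ kerGrading 𝒜 r N k ↔ (x : τ →₀ A) ∈ freeGrading 𝒜 (fun _ : τ => r) k := Iff.rfl

theorem exists_coe_eq {F : Type} [AddCommGroup F] [Module A F] (N : Submodule A F) (f : σ →₀ F)
    (hf : ∀ i, f i ∈ N) : ∃ g : σ →₀ N, ∀ i, (g i : F) = f i := by
  refine ⟨Finsupp.onFinset f.support (fun i => ⟨f i, hf i⟩) fun i hi => ?_, fun i => rfl⟩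
  rw [Finsupp.mem_support_iff]
  exact fun h0 => hi (Subtype.ext h0)

theorem exists_finsupp_lift {F : Type} [AddCommGroup F] (P : F → Prop) (h0 : P 0) (ε : F → M)
    (hε : ε 0 = 0) (f : σ →₀ M) (hf : ∀ i, ∃ x, P x ∧ ε x = f i) :
    ∃ g : σ →₀ F, ∀ i, P (g i) ∧ ε (g i) = f i ∧ (f i = 0 → g i = 0) := by
  classical
  have key : ∀ i, ∃ x, P x ∧ ε x = f i ∧ (f i = 0 → x = 0) := by
    intro i
    by_cases hi : f i = 0
    · exact ⟨0, h0, by rw [hε, hi], fun _ => rfl⟩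
    · obtain ⟨x, hx, hxf⟩ := hf i
      exact ⟨x, hx, hxf, fun h => absurd h hi⟩
  choose g hg using key
  refine ⟨Finsupp.onFinset f.support g fun i hi => ?_, hg⟩
  rw [Finsupp.mem_support_iff]
  exact fun h => hi ((hg i).2.2 h)

/-- The kernel of a linear cover is again exact against the linear complex. -/
theorem IsLinearModule.exact_ker [GradedAlgebra 𝒜] (h : LinearComplex 𝒜 L m o)
    (hM : IsLinearModule 𝒜 L m ℳ r) (ε : (τ →₀ A) →ₗ[A] M)
    (hε : ∀ k, ∀ f ∈ freeGrading 𝒜 (fun _ : τ => r) k, ε f ∈ ℳ k)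
    (hlift : ∀ k, ∀ x ∈ ℳ k, ∃ f ∈ freeGrading 𝒜 (fun _ : τ => r) k, ε f = x) :
    LinearExact (K := K) (M := LinearMap.ker ε) L m (kerGrading 𝒜 r (LinearMap.ker ε))
      (r + 1) := by
  intro n e z he hz hzL hz0
  set z' : σ →₀ τ →₀ A := Finsupp.mapRange.linearMap (LinearMap.ker ε).subtype z with hz'
  have hz'0 : matrixAct m z' = 0 := by
    have h1 := mapRange_linear_matrixAct (M := LinearMap.ker ε) m (LinearMap.ker ε).subtype z
    rw [hz0, map_zero] at h1
    exact h1.symm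
  obtain ⟨w, hw, hwL, hwz⟩ := h.exact_free (τ := τ) r n e z' (by omega) (fun i => hz i)
    (fun i hi => congrArg Subtype.val (hzL i hi)) hz'0
  have hεz' : Finsupp.mapRange.linearMap ε z' = 0 := Finsupp.ext fun i => (z i).2
  obtain ⟨v', hv', hv'L, hv'w⟩ := hM.exact (n + 1) (e - 1) (Finsupp.mapRange.linearMap ε w)
    (by omega) (fun i => hε _ _ (hw i))
    (fun i hi => by
      rw [Finsupp.mapRange.linearMap_apply, Finsupp.mapRange_apply, hwL i hi, map_zero])
    (by rw [← mapRange_linear_matrixAct, hwz, hεz'])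
  obtain ⟨v, hv⟩ := exists_finsupp_lift (· ∈ freeGrading 𝒜 (fun _ : τ => r) (e - 1 - 1))
    (zero_mem _) ε (map_zero ε) v' fun i => by
      obtain ⟨f, hf⟩ := hlift _ _ (hv' i)
      exact ⟨f, hf⟩
  have hvv : Finsupp.mapRange.linearMap ε v = v' := Finsupp.ext fun i => (hv i).2.1
  obtain ⟨hvm, hvL⟩ := IsLinearModule.matrixAct_mem (n := n + 1) (e := e - 1) h
    (fun i j a ha x hx => freeGrading_smul_mem r i j a ha x hx) (fun i => (hv i).1)
    fun i hi => (hv i).2.2 (hv'L i hi)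
  have hker : ∀ i, (w - matrixAct m v) i ∈ LinearMap.ker ε := by
    intro i
    have h1 := DFunLike.congr_fun hv'w i
    rw [← hvv, ← mapRange_linear_matrixAct] at h1
    simp only [Finsupp.mapRange.linearMap_apply, Finsupp.mapRange_apply] at h1
    rw [LinearMap.mem_ker, Finsupp.sub_apply, map_sub ε, h1, sub_self]
  obtain ⟨g, hg⟩ := exists_coe_eq (LinearMap.ker ε) _ hker
  refine ⟨g, fun i => ?_, fun i hi => Subtype.ext ?_, ?_⟩
  · rw [mem_kerGrading, hg, Finsupp.sub_apply]
    exact Submodule.sub_mem _ (hw i) (hvm i)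
  · rw [hg, Finsupp.sub_apply, hwL i hi, hvL i hi, sub_zero]
    rfl
  · have h2 := mapRange_linear_matrixAct (M := LinearMap.ker ε) m (LinearMap.ker ε).subtype g
    have h3 : Finsupp.mapRange.linearMap (LinearMap.ker ε).subtype g = w - matrixAct m v :=
      Finsupp.ext hg
    have h4 := (h2.trans (congrArg (matrixAct m) h3)).trans (map_sub (matrixAct m) _ _)
    rw [h.sq_zero, hwz, sub_zero] at h4
    exact Finsupp.ext fun i => Subtype.ext (DFunLike.congr_fun h4 i)

end LinearModule

section Resolution

variable {K A σ τ : Type} [Field K] [CommRing A] [Algebra K A] {𝒜 : ℤ → Submodule K A}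
  {L : ℕ → σ → Prop} {m : σ → σ →₀ A} {o : σ}
  {M : Type} [AddCommGroup M] [Module A M] [Module K M] {ℳ : ℤ → Submodule K M} {r : ℤ}

theorem IsLinearModule.exists_cover [GradedAlgebra 𝒜] [IsScalarTower K A M]
    (hneg : ∀ i < 0, 𝒜 i = ⊥) (hzero : 𝒜 0 = 1) (h : LinearComplex 𝒜 L m o)
    (hM : IsLinearModule 𝒜 L m ℳ r) :
    ∃ (τ : Type) (ε : (τ →₀ A) →ₗ[A] M), Function.Surjective ε ∧
      (∀ k, ∀ f ∈ freeGrading 𝒜 (fun _ : τ => r) k, ε f ∈ ℳ k) ∧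
      IsLinearModule (K := K) (M := LinearMap.ker ε) 𝒜 L m
        (kerGrading 𝒜 r (LinearMap.ker ε)) (r + 1) := by
  classical
  let b := Module.Basis.ofVectorSpace K (ℳ r)
  refine ⟨Module.Basis.ofVectorSpaceIndex K (ℳ r),
    Finsupp.linearCombination A fun s => (b s : M), ?_⟩
  set ε := Finsupp.linearCombination A fun s => (b s : M) with hε
  have hεapp : ∀ f, ε f = ∑ s ∈ f.support, f s • (b s : M) := fun f => rfl
  have hgr : ∀ k, ∀ f ∈ freeGrading 𝒜 (fun _ => r) k, ε f ∈ ℳ k := by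
    intro k f hf
    rw [hεapp]
    refine Submodule.sum_mem _ fun s _ => ?_
    have := hM.smul_mem (k - r) r _ (hf s) _ (b s).2
    rwa [sub_add_cancel] at this
  have hbot : ∀ f ∈ freeGrading 𝒜 (fun _ => r) r, ε f = 0 → f = 0 := by
    intro f hf hf0
    have hc : ∀ s, ∃ c : K, algebraMap K A c = f s := fun s => by
      have := hf s
      rw [sub_self, hzero] at this
      exact Submodule.mem_one.mp this
    choose c hc using hc
    have hsum : ∑ s ∈ f.support, c s • b s = 0 := by
      refine Subtype.ext ?_
      rw [hεapp] at hf0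
      rw [AddSubmonoidClass.coe_finsetSum, Submodule.coe_zero, ← hf0]
      refine Finset.sum_congr rfl fun s _ => ?_
      rw [Submodule.coe_smul, ← hc, algebraMap_smul]
    ext s
    by_cases hs : s ∈ f.support
    · rw [← hc, linearIndependent_iff'.mp b.linearIndependent f.support c hsum s hs, map_zero]
      rfl
    · exact Finsupp.notMem_support_iff.mp hs
  have hlift := hM.exists_lift h ε fun x hx => by
    refine ⟨Finsupp.mapRange.addMonoidHom (algebraMap K A : K →+ A) (b.repr ⟨x, hx⟩),
      fun s => ?_, ?_⟩
    · rw [sub_self, hzero]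
      exact Submodule.mem_one.mpr ⟨_, rfl⟩
    · have h1 := congrArg Subtype.val (b.linearCombination_repr ⟨x, hx⟩)
      rw [Finsupp.linearCombination_apply, Finsupp.sum, AddSubmonoidClass.coe_finsetSum] at h1
      rw [hε, Finsupp.linearCombination_apply, Finsupp.mapRange.addMonoidHom_apply,
        Finsupp.sum_mapRange_index (h := fun s a => a • (b s : M)) (fun s => zero_smul A _),
        Finsupp.sum]
      refine Eq.trans (Finset.sum_congr rfl fun s _ => ?_) h1
      exact algebraMap_smul A _ _
  refine ⟨fun x => ?_, hgr, ?_, fun x => ?_, fun t f hf hsum k hk => ?_, fun k hk => ?_,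
    hM.exact_ker h ε hgr hlift⟩
  · obtain ⟨t, f, hf, rfl⟩ := hM.exists_sum x
    choose g _ hgf using fun k => hlift k _ (hf k)
    exact ⟨∑ k ∈ t, g k, by rw [map_sum]; exact Finset.sum_congr rfl fun k _ => hgf k⟩
  · exact fun i j a ha x hx => freeGrading_smul_mem r i j a ha x.1 hx
  · obtain ⟨t, f, hf, hx⟩ := exists_sum_freeGrading (𝒜 := 𝒜) r x.1
    have h0 : ∀ k, ε (if k ∈ t then f k else 0) = 0 := by
      intro k
      split_ifs with hk
      · refine hM.eq_zero_of_sum t (fun k => ε (f k)) (fun k => hgr k _ (hf k)) ?_ k hk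
        rw [← map_sum, ← hx]
        exact x.2
      · exact map_zero ε
    refine ⟨t, fun k => ⟨if k ∈ t then f k else 0, h0 k⟩, fun k => ?_, Subtype.ext ?_⟩
    · rw [mem_kerGrading]
      dsimp only
      split_ifs
      exacts [hf k, zero_mem _]
    · rw [hx, AddSubmonoidClass.coe_finsetSum]
      exact Finset.sum_congr rfl fun k hk => (if_pos hk).symm
  · refine Subtype.ext (eq_zero_of_sum_freeGrading r t (fun k => (f k).1) hf ?_ k hk)
    rw [← AddSubmonoidClass.coe_finsetSum, hsum]
    rfl
  · refine (Submodule.eq_bot_iff _).mpr fun x hx => Subtype.ext ?_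
    rw [mem_kerGrading] at hx
    rcases (Int.lt_add_one_iff.mp hk).lt_or_eq with hk | rfl
    · ext s
      have := hx s
      rw [hneg _ (sub_neg.mpr hk)] at this
      exact (Submodule.mem_bot K).mp this
    · exact hbot _ hx x.2

/-- A stage in the construction of a linear resolution: the module of syzygies. -/
structure LinearSyzygy (𝒜 : ℤ → Submodule K A) (L : ℕ → σ → Prop) (m : σ → σ →₀ A) (r : ℤ) where
  index : Type
  syzygy : Submodule A (index →₀ A)
  isLinear : IsLinearModule (K := K) (M := syzygy) 𝒜 L m (kerGrading 𝒜 r syzygy) (r + 1)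

theorem LinearSyzygy.exists_next [GradedAlgebra 𝒜] (hneg : ∀ i < 0, 𝒜 i = ⊥) (hzero : 𝒜 0 = 1)
    (h : LinearComplex 𝒜 L m o) (S : LinearSyzygy 𝒜 L m r) :
    ∃ (S' : LinearSyzygy 𝒜 L m (r + 1)) (d : (S'.index →₀ A) →ₗ[A] (S.index →₀ A)),
      LinearMap.range d = S.syzygy ∧ LinearMap.ker d = S'.syzygy ∧
      ∀ k, ∀ f ∈ freeGrading 𝒜 (fun _ : S'.index => r + 1) k,
        d f ∈ freeGrading 𝒜 (fun _ : S.index => r) k := by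
  obtain ⟨τ, ε, hε, hgr, hlin⟩ := S.isLinear.exists_cover hneg hzero h
  refine ⟨⟨τ, LinearMap.ker ε, hlin⟩, S.syzygy.subtype ∘ₗ ε, ?_, ?_, fun k f hf => hgr k f hf⟩
  · rw [LinearMap.range_comp, LinearMap.range_eq_top.mpr hε, Submodule.map_top,
      Submodule.range_subtype]
  · exact LinearMap.ker_comp_of_ker_eq_bot _ S.syzygy.ker_subtype

/-- A module satisfying `IsLinearModule` has a linear resolution. -/
theorem IsLinearModule.nonempty_resolution [GradedAlgebra 𝒜] [IsScalarTower K A M]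
    (hneg : ∀ i < 0, 𝒜 i = ⊥) (hzero : 𝒜 0 = 1) (h : LinearComplex 𝒜 L m o)
    (hM : IsLinearModule 𝒜 L m ℳ r) (D : ℕ → Set ℤ) (hD : ∀ s : ℕ, r + s ∈ D s) :
    Nonempty (GradedFreeResolution K A 𝒜 M ℳ D) := by
  obtain ⟨τ, ε, hε, hgr, hlin⟩ := hM.exists_cover hneg hzero h
  have hnext : ∀ (n : ℕ) (S : LinearSyzygy 𝒜 L m (r + n)),
      ∃ (S' : LinearSyzygy 𝒜 L m (r + (n + 1 : ℕ)))
        (d : (S'.index →₀ A) →ₗ[A] (S.index →₀ A)),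
        LinearMap.range d = S.syzygy ∧ LinearMap.ker d = S'.syzygy ∧
        ∀ k, ∀ f ∈ freeGrading 𝒜 (fun _ : S'.index => r + ((n + 1 : ℕ) : ℤ)) k,
          d f ∈ freeGrading 𝒜 (fun _ : S.index => r + n) k := by
    intro n S
    rw [show r + ((n + 1 : ℕ) : ℤ) = r + n + 1 by push_cast; omega]
    exact S.exists_next hneg hzero h
  choose next d hrange hker hd using hnext
  let S₀ : LinearSyzygy 𝒜 L m (r + (0 : ℕ)) := ⟨τ, LinearMap.ker ε, by simpa using hlin⟩
  let S : (n : ℕ) → LinearSyzygy 𝒜 L m (r + n) := fun n =>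
    Nat.rec (motive := fun n => LinearSyzygy 𝒜 L m (r + n)) S₀ (fun n => next n) n
  have h₀ : r + ((0 : ℕ) : ℤ) = r := by rw [Nat.cast_zero, add_zero]
  exact ⟨{
    σ := fun n => (S n).index
    deg := fun n _ => r + n
    deg_mem := fun n _ => hD n
    aug := ε
    d := fun n => d n (S n)
    aug_surjective := hε
    aug_graded := fun k f hf => hgr k f (h₀ ▸ hf)
    d_graded := fun n => hd n (S n)
    exact_zero := hrange 0 (S 0)
    exact_succ := fun n => (hrange (n + 1) (S (n + 1))).trans (hker n (S n)).symm }⟩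

end Resolution

section GradedComponent

variable {K B σ τ ι : Type} [Field K] [CommRing B] [Algebra K B] [AddCommGroup ι] [DecidableEq ι]
  (ℬ : ι → Submodule K B) [GradedAlgebra ℬ]

/-- The projection of a graded free module onto its homogeneous elements of a given degree. -/
noncomputable def gradedComponent (deg : σ → ι) (κ : ι) : (σ →₀ B) →ₗ[K] (σ →₀ B) :=
  Finsupp.lsum K fun i => Finsupp.lsingle i ∘ₗ GradedAlgebra.proj ℬ (κ - deg i)

theorem gradedComponent_single (deg : σ → ι) (κ : ι) (i : σ) (b : B) :
    gradedComponent ℬ deg κ (Finsupp.single i b) =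
      Finsupp.single i (GradedAlgebra.proj ℬ (κ - deg i) b) := by
  rw [gradedComponent, Finsupp.lsum_single]
  rfl

theorem gradedComponent_apply (deg : σ → ι) (κ : ι) (x : σ →₀ B) (i : σ) :
    gradedComponent ℬ deg κ x i = GradedAlgebra.proj ℬ (κ - deg i) (x i) := by
  classical
  induction x using Finsupp.induction_linear with
  | zero => simp
  | add x y hx hy => rw [map_add, Finsupp.add_apply, hx, hy, Finsupp.add_apply, map_add]
  | single l b =>
    rw [gradedComponent_single]
    by_cases h : l = i
    · subst h
      simp
    · rw [Finsupp.single_eq_of_ne (Ne.symm h), Finsupp.single_eq_of_ne (Ne.symm h), map_zero]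

theorem gradedComponent_mem (deg : σ → ι) (κ : ι) (x : σ →₀ B) :
    gradedComponent ℬ deg κ x ∈ freeGrading ℬ deg κ := by
  intro i
  rw [gradedComponent_apply, GradedAlgebra.proj_apply]
  exact SetLike.coe_mem _

theorem gradedComponent_of_mem (deg : σ → ι) {κ : ι} {x : σ →₀ B} (hx : x ∈ freeGrading ℬ deg κ) :
    gradedComponent ℬ deg κ x = x := by
  ext i
  rw [gradedComponent_apply, GradedAlgebra.proj_apply]
  exact DirectSum.decompose_of_mem_same ℬ (hx i)

theorem gradedComponent_of_mem_ne (deg : σ → ι) {κ κ' : ι} {x : σ →₀ B}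
    (hx : x ∈ freeGrading ℬ deg κ') (h : κ' ≠ κ) : gradedComponent ℬ deg κ x = 0 := by
  ext i
  rw [gradedComponent_apply, GradedAlgebra.proj_apply]
  exact DirectSum.decompose_of_mem_ne ℬ (hx i) fun h' => h (sub_left_injective h')

variable {ℬ} {deg : σ → ι} {deg' : τ → ι}

theorem gradedComponent_comm {f : (σ →₀ B) →ₗ[B] (τ →₀ B)}
    (hf : IsGradedMap (K := K) (freeGrading ℬ deg) (freeGrading ℬ deg') f) (κ : ι) (x : σ →₀ B) :
    f (gradedComponent ℬ deg κ x) = gradedComponent ℬ deg' κ (f x) := by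
  classical
  induction x using Finsupp.induction_linear with
  | zero => simp
  | add x y hx hy => simp only [map_add, hx, hy]
  | single i b =>
    induction b using DirectSum.Decomposition.inductionOn ℬ with
    | zero => simp
    | add x y hx hy => simp only [Finsupp.single_add, map_add, hx, hy]
    | @homogeneous k b =>
      have hb : Finsupp.single i (b : B) ∈ freeGrading ℬ deg (k + deg i) := by
        intro l
        rw [Finsupp.single_apply]
        split_ifs with h
        · rw [h, add_sub_cancel_right]
          exact b.2
        · exact zero_mem _
      by_cases hk : k + deg i = κ
      · subst hk
        rw [gradedComponent_of_mem ℬ _ hb, gradedComponent_of_mem ℬ _ (hf _ _ hb)]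
      · rw [gradedComponent_of_mem_ne ℬ _ hb hk, gradedComponent_of_mem_ne ℬ _ (hf _ _ hb) hk,
          map_zero]

theorem exists_mem_of_mem_range {f : (σ →₀ B) →ₗ[B] (τ →₀ B)}
    (hf : IsGradedMap (K := K) (freeGrading ℬ deg) (freeGrading ℬ deg') f) {κ : ι} {y : τ →₀ B}
    (hy : y ∈ freeGrading ℬ deg' κ) (hyf : y ∈ LinearMap.range f) :
    ∃ x ∈ freeGrading ℬ deg κ, f x = y := by
  obtain ⟨x, rfl⟩ := hyf
  exact ⟨_, gradedComponent_mem ℬ deg κ x, by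
    rw [gradedComponent_comm hf, gradedComponent_of_mem ℬ _ hy]⟩

theorem one_notMem_irrelevant [Nontrivial B] (h : ∀ i : ι, i ≠ 0 → ℬ i = ⊥ ∨ ℬ (-i) = ⊥) :
    (1 : B) ∉ irrelevant ℬ := by
  intro h1
  have key : ∀ x ∈ irrelevant ℬ, GradedAlgebra.proj ℬ 0 x = 0 := by
    intro x hx
    induction hx using Submodule.span_induction with
    | zero => exact map_zero _
    | add x y _ _ hx hy => rw [map_add, hx, hy, add_zero]
    | mem x hx =>
      obtain ⟨i, hi, hx⟩ := hx
      rw [GradedAlgebra.proj_apply]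
      exact DirectSum.decompose_of_mem_ne ℬ hx hi
    | smul b x _ hx =>
      rw [smul_eq_mul]
      induction b using DirectSum.Decomposition.inductionOn ℬ with
      | zero => rw [zero_mul, map_zero]
      | add b c hb hc => rw [add_mul, map_add, hb, hc, add_zero]
      | @homogeneous k b =>
        have h1 := DirectSum.coe_decompose_mul_add_of_left_mem ℬ (i := k) (j := -k) (b := x) b.2
        rw [add_neg_cancel] at h1
        rw [GradedAlgebra.proj_apply, h1]
        rcases eq_or_ne k 0 with rfl | hk
        · rw [GradedAlgebra.proj_apply] at hx
          rw [neg_zero, hx, mul_zero]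
        · rcases h k hk with h2 | h2
          · rw [(Submodule.mem_bot K).mp (h2.le b.2), zero_mul]
          · rw [(Submodule.mem_bot K).mp
              (h2.le (SetLike.coe_mem (DirectSum.decompose ℬ x (-k)))), mul_zero]
  have h2 := key 1 h1
  rw [GradedAlgebra.proj_apply, DirectSum.decompose_of_mem_same ℬ SetLike.GradedOne.one_mem] at h2
  exact one_ne_zero h2

end GradedComponent

section Assemble

variable {K B M : Type} [Field K] [CommRing B] [Algebra K B] {ℬ : ℤ × ℤ → Submodule K B}
  [AddCommGroup M] [Module B M] [Module K M] {ℳ : ℤ × ℤ → Submodule K M} {D : ℕ → Set (ℤ × ℤ)}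

namespace GradedFreeResolution

/-- The degrees of the basis elements of all the free modules of a resolution. -/
def totalDeg (R : GradedFreeResolution K B ℬ M ℳ D) (i : Σ s, R.σ s) : ℤ × ℤ :=
  R.deg i.1 i.2

/-- The inclusion of one of the free modules of a resolution into their direct sum. -/
noncomputable def embed (R : GradedFreeResolution K B ℬ M ℳ D) (s : ℕ) :
    (R.σ s →₀ B) →ₗ[B] ((Σ s, R.σ s) →₀ B) :=
  Finsupp.lmapDomain B B (Sigma.mk s)

/-- The matrix of the differential of a resolution, without the augmentation. -/
noncomputable def matrix (R : GradedFreeResolution K B ℬ M ℳ D) :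
    (Σ s, R.σ s) → (Σ s, R.σ s) →₀ B
  | ⟨0, _⟩ => 0
  | ⟨s + 1, i⟩ => R.embed s (R.d s (Finsupp.single i 1))

variable (R : GradedFreeResolution K B ℬ M ℳ D)

theorem embed_single (s : ℕ) (i : R.σ s) (b : B) :
    R.embed s (Finsupp.single i b) = Finsupp.single ⟨s, i⟩ b :=
  Finsupp.mapDomain_single

theorem embed_apply (s : ℕ) (x : R.σ s →₀ B) (i : R.σ s) : R.embed s x ⟨s, i⟩ = x i :=
  Finsupp.mapDomain_apply sigma_mk_injective x i

theorem embed_apply_of_ne {s : ℕ} (x : R.σ s →₀ B) {i : Σ s, R.σ s} (h : i.1 ≠ s) :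
    R.embed s x i = 0 := by
  refine Finsupp.mapDomain_of_notMem_range x i ?_
  rintro ⟨l, rfl⟩
  exact h rfl

theorem embed_injective (s : ℕ) : Function.Injective (R.embed s) :=
  Finsupp.mapDomain_injective sigma_mk_injective

theorem exists_embed_eq {s : ℕ} (x : (Σ s, R.σ s) →₀ B) (h : ∀ i, i.1 ≠ s → x i = 0) :
    ∃ y, R.embed s y = x := by
  refine ⟨Finsupp.comapDomain (Sigma.mk s) x sigma_mk_injective.injOn, ?_⟩
  refine Finsupp.mapDomain_comapDomain _ sigma_mk_injective _ ?_
  rintro ⟨t, i⟩ hi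
  by_cases ht : t = s
  · subst ht
    exact ⟨i, rfl⟩
  · exact absurd (h _ ht) (Finsupp.mem_support_iff.mp hi)

theorem matrixAct_embed_zero (x : R.σ 0 →₀ B) : matrixAct R.matrix (R.embed 0 x) = 0 := by
  refine LinearMap.congr_fun (f := matrixAct R.matrix ∘ₗ R.embed 0) (g := 0)
    (Finsupp.lhom_ext fun i b => ?_) x
  rw [LinearMap.comp_apply, embed_single]
  refine Finsupp.ext fun l => ?_
  rw [matrixAct_single]
  exact zero_smul _ _

theorem matrixAct_embed_succ (s : ℕ) (x : R.σ (s + 1) →₀ B) :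
    matrixAct R.matrix (R.embed (s + 1) x) = R.embed s (R.d s x) := by
  refine LinearMap.congr_fun (f := matrixAct R.matrix ∘ₗ R.embed (s + 1))
    (g := R.embed s ∘ₗ R.d s) (Finsupp.lhom_ext fun i b => ?_) x
  rw [LinearMap.comp_apply, embed_single]
  refine Finsupp.ext fun l => ?_
  rw [matrixAct_single, LinearMap.comp_apply, ← mul_one b, ← smul_eq_mul b,
    ← Finsupp.smul_single, map_smul, map_smul, Finsupp.smul_apply, smul_eq_mul, smul_eq_mul,
    smul_eq_mul, mul_one, mul_comm]
  rfl

theorem d_comp (s : ℕ) (x : R.σ (s + 2) →₀ B) : R.d s (R.d (s + 1) x) = 0 := by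
  rw [← LinearMap.mem_ker, ← R.exact_succ]
  exact ⟨x, rfl⟩

theorem matrixAct_sq (x : (Σ s, R.σ s) →₀ B) :
    matrixAct R.matrix (matrixAct R.matrix x) = 0 := by
  classical
  induction x using Finsupp.induction_linear with
  | zero => simp
  | add x y hx hy => rw [map_add, map_add, hx, hy, add_zero]
  | single i b =>
    obtain ⟨s, i⟩ := i
    rw [← embed_single]
    match s, i with
    | 0, i => rw [matrixAct_embed_zero, map_zero]
    | 1, i => rw [matrixAct_embed_succ, matrixAct_embed_zero]
    | s + 2, i => rw [matrixAct_embed_succ, matrixAct_embed_succ, d_comp, map_zero]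

end GradedFreeResolution

section Koszul

variable (R : GradedFreeResolution K B ℬ (B ⧸ irrelevant ℬ) (residueGrading K B ℬ)
    fun s => {v : ℤ × ℤ | v.1 + v.2 = (s : ℤ)})

theorem single_one_mem_freeGrading [GradedAlgebra ℬ] {σ : Type} (deg : σ → ℤ × ℤ) (i : σ) :
    Finsupp.single i (1 : B) ∈ freeGrading ℬ deg (deg i) := by
  classical
  intro l
  rw [Finsupp.single_apply]
  split_ifs with h
  · rw [h, sub_self]
    exact SetLike.GradedOne.one_mem
  · exact zero_mem _

theorem eq_zero_of_mem_freeGrading 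
    (hbot : ∀ p : ℤ × ℤ, p.1 < 0 ∨ p.2 < 0 → ℬ p = ⊥) {s : ℕ} {κ : ℤ × ℤ} (hκ : totalDegree κ < s)
    {x : R.σ s →₀ B} (hx : x ∈ freeGrading ℬ (R.deg s) κ) : x = 0 := by
  ext i
  have h1 := hx i
  have h2 : (R.deg s i).1 + (R.deg s i).2 = s := R.deg_mem s i
  have h3 : κ.1 + κ.2 < s := hκ
  rw [hbot _ (by rw [Prod.fst_sub, Prod.snd_sub]; omega)] at h1
  exact h1

theorem aug_single_ne_zero [GradedAlgebra ℬ] [Nontrivial B]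
    (hbot : ∀ p : ℤ × ℤ, p.1 < 0 ∨ p.2 < 0 → ℬ p = ⊥) (i : R.σ 0) : R.aug (Finsupp.single i 1) ≠ 0 := by
  intro h
  obtain ⟨y, hy, hyi⟩ := exists_mem_of_mem_range (R.d_graded 0)
    (single_one_mem_freeGrading (ℬ := ℬ) (R.deg 0) i) (by rw [R.exact_zero]; exact h)
  have h2 : (R.deg 0 i).1 + (R.deg 0 i).2 = (0 : ℕ) := R.deg_mem 0 i
  rw [eq_zero_of_mem_freeGrading R hbot
    (by rw [totalDegree, h2]; norm_num) hy, map_zero] at hyi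
  exact one_ne_zero (Finsupp.single_eq_zero.mp hyi.symm)

theorem d_single_ne_zero [GradedAlgebra ℬ] [Nontrivial B]
    (hbot : ∀ p : ℤ × ℤ, p.1 < 0 ∨ p.2 < 0 → ℬ p = ⊥) (s : ℕ) (i : R.σ (s + 1)) : R.d s (Finsupp.single i 1) ≠ 0 := by
  intro h
  obtain ⟨y, hy, hyi⟩ := exists_mem_of_mem_range (R.d_graded (s + 1))
    (single_one_mem_freeGrading (ℬ := ℬ) (R.deg (s + 1)) i) (by rw [R.exact_succ]; exact h)
  have h2 : (R.deg (s + 1) i).1 + (R.deg (s + 1) i).2 = (s + 1 : ℕ) := R.deg_mem (s + 1) i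
  rw [eq_zero_of_mem_freeGrading R hbot
    (by rw [totalDegree, h2]; push_cast; omega) hy, map_zero] at hyi
  exact one_ne_zero (Finsupp.single_eq_zero.mp hyi.symm)

theorem deg_zero_eq [GradedAlgebra ℬ] [Nontrivial B]
    (hbot : ∀ p : ℤ × ℤ, p.1 < 0 ∨ p.2 < 0 → ℬ p = ⊥) (i : R.σ 0) : R.deg 0 i = 0 := by
  by_contra h
  have h1 := R.aug_graded _ _ (single_one_mem_freeGrading (ℬ := ℬ) (R.deg 0) i)
  rw [residueGrading, if_neg h, Submodule.mem_bot] at h1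
  exact aug_single_ne_zero R hbot i h1

theorem deg_nonneg [GradedAlgebra ℬ] [Nontrivial B]
    (hbot : ∀ p : ℤ × ℤ, p.1 < 0 ∨ p.2 < 0 → ℬ p = ⊥) (s : ℕ) (i : R.σ s) : 0 ≤ R.deg s i := by
  induction s with
  | zero => rw [deg_zero_eq R hbot]
  | succ s ih =>
    obtain ⟨l, hl⟩ := Finsupp.ne_iff.mp (d_single_ne_zero R hbot s i)
    have h1 := R.d_graded s _ _ (single_one_mem_freeGrading (ℬ := ℬ) (R.deg (s + 1)) i) l
    have h2 : ¬ ((R.deg (s + 1) i - R.deg s l).1 < 0 ∨ (R.deg (s + 1) i - R.deg s l).2 < 0) := by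
      intro h3
      rw [hbot _ h3] at h1
      exact hl h1
    have h4 := ih l
    rw [Prod.le_def] at h4 ⊢
    simp only [Prod.fst_sub, Prod.snd_sub, Prod.fst_zero, Prod.snd_zero] at h2 h4 ⊢
    omega

theorem exists_algebraMap_mk_eq [GradedAlgebra ℬ]
    (hzero : ℬ 0 = 1) (y : B ⧸ irrelevant ℬ) :
    ∃ c : K, Ideal.Quotient.mk (irrelevant ℬ) (algebraMap K B c) = y := by
  obtain ⟨b, rfl⟩ := Ideal.Quotient.mk_surjective y
  induction b using DirectSum.Decomposition.inductionOn ℬ with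
  | zero => exact ⟨0, by rw [map_zero]⟩
  | add b b' hb hb' =>
    obtain ⟨c, hc⟩ := hb
    obtain ⟨c', hc'⟩ := hb'
    exact ⟨c + c', by rw [map_add, map_add, hc, hc', map_add]⟩
  | @homogeneous k b =>
    rcases eq_or_ne k 0 with rfl | hk
    · obtain ⟨c, hc⟩ := Submodule.mem_one.mp (hzero.le b.2)
      exact ⟨c, by rw [hc]⟩
    · exact ⟨0, by
        rw [map_zero, map_zero, eq_comm, Ideal.Quotient.eq_zero_iff_mem]
        exact Ideal.subset_span ⟨k, hk, b.2⟩⟩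

theorem subsingleton_base [GradedAlgebra ℬ] [Nontrivial B]
    (hbot : ∀ p : ℤ × ℤ, p.1 < 0 ∨ p.2 < 0 → ℬ p = ⊥)
    (hzero : ℬ 0 = 1) : Subsingleton (R.σ 0) := by
  classical
  refine ⟨fun i l => ?_⟩
  by_contra hil
  obtain ⟨a, ha⟩ := exists_algebraMap_mk_eq hzero (R.aug (Finsupp.single i 1))
  obtain ⟨c, hc⟩ := exists_algebraMap_mk_eq hzero (R.aug (Finsupp.single l 1))
  have hc0 : c ≠ 0 := by
    rintro rfl
    rw [map_zero, map_zero] at hc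
    exact aug_single_ne_zero R hbot l hc.symm
  have hsingle : ∀ (j : R.σ 0) (c : K),
      Finsupp.single j (algebraMap K B c) ∈ freeGrading ℬ (R.deg 0) 0 := by
    intro j c t
    rw [deg_zero_eq R hbot, sub_zero, hzero, Finsupp.single_apply]
    split_ifs
    exacts [Submodule.mem_one.mpr ⟨c, rfl⟩, zero_mem _]
  have haug : ∀ (j : R.σ 0) (b : B), R.aug (Finsupp.single j b) =
      Ideal.Quotient.mk (irrelevant ℬ) b * R.aug (Finsupp.single j 1) := by
    intro j b
    rw [← mul_one b, ← smul_eq_mul, ← Finsupp.smul_single, map_smul, smul_eq_mul, mul_one]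
    rfl
  obtain ⟨y, hy, hyi⟩ := exists_mem_of_mem_range (R.d_graded 0)
    (sub_mem (hsingle i c) (hsingle l a)) (by
      rw [R.exact_zero, LinearMap.mem_ker, map_sub, haug i, haug l, ← ha, ← hc, mul_comm, sub_self])
  rw [eq_zero_of_mem_freeGrading R hbot (by rw [totalDegree]; norm_num) hy, map_zero] at hyi
  have h1 := DFunLike.congr_fun hyi i
  rw [Finsupp.sub_apply, Finsupp.single_eq_same, Finsupp.single_eq_of_ne hil, sub_zero] at h1
  exact hc0 ((map_eq_zero_iff _ (algebraMap K B).injective).mp h1.symm)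

theorem nonempty_base [GradedAlgebra ℬ] [Nontrivial B]
    (hbot : ∀ p : ℤ × ℤ, p.1 < 0 ∨ p.2 < 0 → ℬ p = ⊥) : Nonempty (R.σ 0) := by
  by_contra h
  rw [not_nonempty_iff] at h
  obtain ⟨x, hx⟩ := R.aug_surjective (Ideal.Quotient.mk _ 1)
  rw [Subsingleton.elim x 0, map_zero] at hx
  refine one_notMem_irrelevant (ℬ := ℬ) (fun p hp => ?_) (Ideal.Quotient.eq_zero_iff_mem.mp hx.symm)
  by_cases h1 : p.1 < 0 ∨ p.2 < 0
  · exact Or.inl (hbot p h1)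
  · refine Or.inr (hbot (-p) ?_)
    rw [Ne, Prod.ext_iff] at hp
    simp only [Prod.fst_neg, Prod.snd_neg, Prod.fst_zero, Prod.snd_zero] at hp ⊢
    omega

theorem exists_linearResolution [GradedAlgebra ℬ] [Nontrivial B]
    (hbot : ∀ p : ℤ × ℤ, p.1 < 0 ∨ p.2 < 0 → ℬ p = ⊥) (hzero : ℬ 0 = 1) (hk : IsKoszulBi K B ℬ) :
    ∃ (σ : Type) (deg : σ → ℤ × ℤ) (m : σ → σ →₀ B) (o : σ), LinearResolution ℬ deg m o := by
  classical
  obtain ⟨R⟩ := hk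
  have htotal : ∀ i, totalDegree (R.totalDeg i) = i.1 := fun i => R.deg_mem i.1 i.2
  have hmem : ∀ (s : ℕ) (κ : ℤ × ℤ) (x : R.σ s →₀ B), x ∈ freeGrading ℬ (R.deg s) κ →
      R.embed s x ∈ supportedPart ℬ R.totalDeg (fun i => totalDegree (R.totalDeg i) = s) κ := by
    intro s κ x hx i
    by_cases h : i.1 = s
    · obtain ⟨t, i⟩ := i
      obtain rfl : t = s := h
      rw [R.embed_apply]
      exact ⟨hx i, fun h => absurd (htotal _) h⟩
    · rw [R.embed_apply_of_ne x h]
      exact ⟨zero_mem _, fun _ => rfl⟩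
  obtain ⟨o⟩ := nonempty_base R hbot
  refine ⟨_, R.totalDeg, R.matrix, ⟨0, o⟩, hbot, fun i => (deg_nonneg R hbot i.1 i.2).1,
    fun i => (deg_nonneg R hbot i.1 i.2).2, ?_, ?_, R.matrixAct_sq, ?_, deg_zero_eq R hbot o, ?_⟩
  · rintro ⟨_ | s, i⟩ l
    · exact zero_mem _
    · exact (hmem s _ _ (R.d_graded s _ _ (single_one_mem_freeGrading (R.deg (s + 1)) i)) l).1
  · rintro ⟨_ | s, i⟩ l hl
    · exact absurd rfl hl
    · rw [htotal, htotal]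
      by_contra h
      refine hl (R.embed_apply_of_ne _ fun h' => h ?_)
      rw [h']
      push_cast
      rfl
  · intro s κ x hx hx0 hs
    obtain ⟨y, rfl⟩ := R.exists_embed_eq (s := s) x fun i hi => (hx i).2 fun h =>
      hi (by exact_mod_cast (htotal i).symm.trans h)
    have hy : y ∈ freeGrading ℬ (R.deg s) κ := fun i => by
      have := (hx ⟨s, i⟩).1
      rwa [R.embed_apply] at this
    have hrange : y ∈ LinearMap.range (R.d s) := by
      cases s with
      | zero =>
        have h1 := R.aug_graded _ _ hy
        rw [residueGrading, if_neg (hs.resolve_right (by norm_num))] at h1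
        rw [R.exact_zero]
        exact h1
      | succ s =>
        rw [R.matrixAct_embed_succ] at hx0
        rw [R.exact_succ]
        exact R.embed_injective s (hx0.trans (map_zero _).symm)
    obtain ⟨z, hz, rfl⟩ := exists_mem_of_mem_range (R.d_graded s) hy hrange
    exact ⟨_, hmem _ _ _ hz, R.matrixAct_embed_succ s z⟩
  · rintro ⟨s, i⟩ hi
    obtain rfl : s = 0 := by
      rw [htotal] at hi
      exact_mod_cast hi
    have := subsingleton_base R hbot hzero
    rw [Subsingleton.elim i o]

end Koszul

end Assemble

section Rees

open Polynomial

variable {K A : Type} [Field K] [CommRing A] [Algebra K A] {𝒜 : ℤ → Submodule K A} {I : Ideal A}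
  {d : ℕ}

theorem exists_of_mem_reesGrading {k : ℤ} {j : ℕ} {y : A[X]}
    (hy : y ∈ reesGrading K A 𝒜 I d (k, j)) :
    ∃ x ∈ I ^ j, x ∈ 𝒜 (k + d * j) ∧ y = C x * X ^ j := by
  induction hy using Submodule.span_induction with
  | zero => exact ⟨0, zero_mem _, zero_mem _, by rw [map_zero, zero_mul]⟩
  | mem y hy =>
    obtain ⟨i, x, hi, hx, hxk, rfl⟩ := hy
    obtain rfl : i = j := Nat.cast_injective (R := ℤ) hi
    exact ⟨x, hx, hxk, rfl⟩
  | add y z _ _ hy hz =>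
    obtain ⟨a, ha, ha', rfl⟩ := hy
    obtain ⟨b, hb, hb', rfl⟩ := hz
    exact ⟨a + b, add_mem ha hb, add_mem ha' hb', by rw [map_add, add_mul]⟩
  | smul c y _ hy =>
    obtain ⟨a, ha, ha', rfl⟩ := hy
    refine ⟨c • a, ?_, Submodule.smul_mem _ c ha', by rw [← smul_C, smul_mul_assoc]⟩
    rw [Algebra.smul_def]
    exact Ideal.mul_mem_left _ _ ha

theorem mem_reesGrading {k : ℤ} {j : ℕ} {x : A} (hx : x ∈ I ^ j) (hxk : x ∈ 𝒜 (k + d * j)) :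
    C x * X ^ j ∈ reesGrading K A 𝒜 I d (k, j) :=
  Submodule.subset_span ⟨j, x, rfl, hx, hxk, rfl⟩

theorem reesGrading_eq_bot_of_neg {p : ℤ × ℤ} (hp : p.2 < 0) : reesGrading K A 𝒜 I d p = ⊥ := by
  rw [eq_bot_iff, reesGrading, Submodule.span_le]
  rintro _ ⟨j, x, hj, -⟩
  omega

theorem isHomogeneous_pow [GradedAlgebra 𝒜] (hI : I.IsHomogeneous 𝒜) (j : ℕ) :
    (I ^ j).IsHomogeneous 𝒜 := by
  induction j with
  | zero =>
    rw [pow_zero, Ideal.one_eq_top]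
    exact fun _ _ _ => Submodule.mem_top
  | succ j ih =>
    rw [pow_succ]
    exact ih.mul hI

theorem proj_eq_zero_of_mem_pow [GradedAlgebra 𝒜] (hneg : ∀ i < 0, 𝒜 i = ⊥)
    (hI : I = Ideal.span ((I : Set A) ∩ (𝒜 (d : ℤ) : Set A))) (j : ℕ) :
    ∀ x ∈ I ^ j, ∀ e : ℤ, e < d * j → GradedAlgebra.proj 𝒜 e x = 0 := by
  induction j with
  | zero =>
    intro x _ e he
    have h1 : GradedAlgebra.proj 𝒜 e x ∈ 𝒜 e := by
      rw [GradedAlgebra.proj_apply]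
      exact SetLike.coe_mem _
    rwa [hneg e (by simpa using he), Submodule.mem_bot] at h1
  | succ j ih =>
    intro x hx e he
    rw [pow_succ] at hx
    induction hx using Submodule.mul_induction_on' with
    | add x _ y _ hx hy => rw [map_add, hx, hy, add_zero]
    | mem_mul_mem x hx y hy =>
      rw [hI] at hy
      induction hy using Submodule.span_induction generalizing x with
      | zero => rw [mul_zero, map_zero]
      | add y z _ _ hy hz => rw [mul_add, map_add, hy x hx, hz x hx, add_zero]
      | smul a y _ hy =>
        rw [smul_eq_mul, ← mul_assoc]
        exact hy _ (Ideal.mul_mem_right _ _ hx)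
      | mem y hy =>
        have h1 := DirectSum.coe_decompose_mul_add_of_right_mem 𝒜 (i := e - d) (a := x) hy.2
        rw [sub_add_cancel] at h1
        have h2 := ih x hx (e - d) (by push_cast at he; linarith)
        rw [GradedAlgebra.proj_apply] at h2 ⊢
        rw [h1, h2, zero_mul]

theorem reesGrading_eq_bot [GradedAlgebra 𝒜] (hneg : ∀ i < 0, 𝒜 i = ⊥)
    (hI : I = Ideal.span ((I : Set A) ∩ (𝒜 (d : ℤ) : Set A))) {p : ℤ × ℤ}
    (hp : p.1 < 0 ∨ p.2 < 0) : reesGrading K A 𝒜 I d p = ⊥ := by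
  rcases lt_or_ge p.2 0 with h2 | h2
  · exact reesGrading_eq_bot_of_neg h2
  · obtain ⟨k, j⟩ := p
    obtain ⟨j, rfl⟩ := Int.eq_ofNat_of_zero_le h2
    rw [eq_bot_iff]
    intro y hy
    obtain ⟨x, hx, hxk, rfl⟩ := exists_of_mem_reesGrading hy
    have h1 := proj_eq_zero_of_mem_pow hneg hI j x hx (k + d * j) (by
      have := hp.resolve_right (not_lt.mpr h2)
      simp only at this
      omega)
    rw [GradedAlgebra.proj_apply, DirectSum.decompose_of_mem_same 𝒜 hxk] at h1
    rw [h1, map_zero, zero_mul]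
    exact zero_mem _

variable {B σ : Type} [CommRing B] [Algebra K B] {ℬ : ℤ × ℤ → Submodule K B} {φ : B →ₐ[K] A[X]}

theorem exists_of_mem_rees (hφ : ∀ p, Submodule.map φ.toLinearMap (ℬ p) = reesGrading K A 𝒜 I d p)
    {k : ℤ} {j : ℕ} {b : B} (hb : b ∈ ℬ (k, j)) :
    ∃ x ∈ I ^ j, x ∈ 𝒜 (k + d * j) ∧ φ b = C x * X ^ j :=
  exists_of_mem_reesGrading (hφ (k, j) ▸ Submodule.mem_map_of_mem hb)

theorem exists_mem_rees (hφ : ∀ p, Submodule.map φ.toLinearMap (ℬ p) = reesGrading K A 𝒜 I d p)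
    {k : ℤ} {j : ℕ} {x : A} (hx : x ∈ I ^ j) (hxk : x ∈ 𝒜 (k + d * j)) :
    ∃ b ∈ ℬ (k, j), φ b = C x * X ^ j := by
  have h1 := mem_reesGrading (K := K) (d := d) hx hxk
  rw [← hφ] at h1
  exact h1

theorem rees_eq_bot [GradedAlgebra 𝒜] (hneg : ∀ i < 0, 𝒜 i = ⊥)
    (hI : I = Ideal.span ((I : Set A) ∩ (𝒜 (d : ℤ) : Set A))) (hφinj : Function.Injective φ)
    (hφ : ∀ p, Submodule.map φ.toLinearMap (ℬ p) = reesGrading K A 𝒜 I d p) (p : ℤ × ℤ)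
    (hp : p.1 < 0 ∨ p.2 < 0) : ℬ p = ⊥ := by
  have h1 := hφ p
  rwa [reesGrading_eq_bot hneg hI hp, ← Submodule.map_bot φ.toLinearMap,
    (Submodule.map_injective_of_injective (f := φ.toLinearMap) hφinj).eq_iff] at h1

theorem rees_zero [GradedAlgebra ℬ] (hzero : 𝒜 0 = 1) (hφinj : Function.Injective φ)
    (hφ : ∀ p, Submodule.map φ.toLinearMap (ℬ p) = reesGrading K A 𝒜 I d p) : ℬ 0 = 1 := by
  refine le_antisymm (fun b hb => ?_) (Submodule.one_le.mpr SetLike.GradedOne.one_mem)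
  obtain ⟨x, -, hx, hbx⟩ := exists_of_mem_rees (k := 0) (j := 0) hφ hb
  rw [Nat.cast_zero, mul_zero, add_zero, hzero, Submodule.mem_one] at hx
  obtain ⟨c, rfl⟩ := hx
  refine Submodule.mem_one.mpr ⟨c, hφinj ?_⟩
  rw [hbx, pow_zero, mul_one, AlgHom.commutes]
  rfl

/-- The projection of a subalgebra of `A[X]` onto the constant coefficients. -/
noncomputable def constantPart (φ : B →ₐ[K] A[X]) : B →+* A :=
  constantCoeff.comp φ.toRingHom

theorem constantPart_of_eq {b : B} {x : A} (h : φ b = C x) : constantPart φ b = x := by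
  change constantCoeff (φ b) = x
  rw [h, constantCoeff_apply, coeff_C_zero]

/-- The image of a matrix over the Rees algebra in the base ring. -/
noncomputable def constantMatrix (φ : B →ₐ[K] A[X]) (m : σ → σ →₀ B) (i : σ) : σ →₀ A :=
  (m i).mapRange (constantPart φ) (map_zero _)

theorem constantMatrix_apply (m : σ → σ →₀ B) (i l : σ) :
    constantMatrix φ m i l = constantPart φ (m i l) := rfl

theorem constantMatrix_sq_zero {m : σ → σ →₀ B}
    (hm : ∀ x : σ →₀ B, matrixAct m (matrixAct m x) = 0) {M : Type} [AddCommGroup M] [Module A M]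
    (f : σ →₀ M) : matrixAct (constantMatrix φ m) (matrixAct (constantMatrix φ m) f) = 0 := by
  classical
  induction f using Finsupp.induction_linear with
  | zero => rw [map_zero, map_zero]
  | add f g hf hg => rw [map_add, map_add, hf, hg, add_zero]
  | single i x =>
    have h1 : matrixAct m (m i) = 0 := by
      have h2 : m i = matrixAct m (Finsupp.single i 1) := Finsupp.ext fun l => by
        rw [matrixAct_single, smul_eq_mul, mul_one]
      rw [h2, hm]
    have h2 : matrixAct (constantMatrix φ m) (constantMatrix φ m i) = 0 := by
      have h3 := mapRange_matrixAct m (constantMatrix φ m) (constantPart φ).toAddMonoidHom (m i)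
        fun i l => map_mul (constantPart φ) _ _
      rw [h1, map_zero] at h3
      exact h3.symm
    have hs : (matrixAct (constantMatrix φ m) (Finsupp.single i x)).support ⊆
        (constantMatrix φ m i).support := by
      intro l
      rw [Finsupp.mem_support_iff, Finsupp.mem_support_iff, matrixAct_single]
      exact fun h h' => h (by rw [h', zero_smul])
    refine Finsupp.ext fun l => ?_
    rw [matrixAct_apply_of_subset _ _ _ hs]
    have h3 := DFunLike.congr_fun h2 l
    rw [matrixAct_apply] at h3
    simp only [matrixAct_single, ← mul_smul]
    rw [← Finset.sum_smul]
    simp only [smul_eq_mul] at h3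
    rw [h3]
    exact zero_smul _ _

namespace LinearResolution

variable {deg : σ → ℤ × ℤ} {m : σ → σ →₀ B} {o : σ}

theorem entry_of_lin (h : LinearResolution ℬ deg m o)
    (hφ : ∀ p, Submodule.map φ.toLinearMap (ℬ p) = reesGrading K A 𝒜 I d p) {n : ℕ} {i : σ}
    (hi : deg i = ((n : ℤ), 0)) (l : σ) :
    constantMatrix φ m i l ∈ 𝒜 1 ∧ φ (m i l) = C (constantMatrix φ m i l) := by
  rw [constantMatrix_apply]
  by_cases hil : m i l = 0
  · rw [hil, map_zero, map_zero, map_zero]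
    exact ⟨zero_mem _, rfl⟩
  · obtain _ | n := n
    · exact (h.lin_zero_step i l hi hil).elim
    · have h1 := h.entry_mem i l
      rw [h.lin_step n i l hi hil, hi, Prod.mk_sub_mk, sub_zero, Nat.cast_succ, add_sub_cancel_left]
        at h1
      obtain ⟨x, -, hx, hxe⟩ := exists_of_mem_rees (j := 0) hφ h1
      rw [pow_zero, mul_one] at hxe
      rw [Nat.cast_zero, mul_zero, add_zero] at hx
      rw [constantPart_of_eq hxe]
      exact ⟨hx, hxe⟩

theorem map_matrixAct (h : LinearResolution ℬ deg m o)
    (hφ : ∀ p, Submodule.map φ.toLinearMap (ℬ p) = reesGrading K A 𝒜 I d p) {n j : ℕ}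
    {x : σ →₀ B} {f : σ →₀ A} (hx : ∀ i, deg i ≠ ((n : ℤ), 0) → x i = 0)
    (hf : ∀ i, φ (x i) = C (f i) * X ^ j) (l : σ) :
    φ (matrixAct m x l) = C (matrixAct (constantMatrix φ m) f l) * X ^ j := by
  classical
  rw [matrixAct_apply_of_subset _ _ _ (Finset.subset_union_left (s₂ := f.support)),
    matrixAct_apply_of_subset _ _ _ (Finset.subset_union_right (s₁ := x.support)), map_sum,
    map_sum, Finset.sum_mul]
  refine Finset.sum_congr rfl fun i _ => ?_
  rw [smul_eq_mul, smul_eq_mul, map_mul, map_mul, mul_assoc, ← hf]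
  by_cases hi : deg i = ((n : ℤ), 0)
  · rw [(h.entry_of_lin hφ hi l).2]
  · rw [hx i hi, map_zero, mul_zero, mul_zero]

/-- The exactness of the strips of the resolution, in terms of the powers of the ideal. -/
theorem exists_pow_preimage [GradedAlgebra ℬ] (h : LinearResolution ℬ deg m o)
    (hφinj : Function.Injective φ)
    (hφ : ∀ p, Submodule.map φ.toLinearMap (ℬ p) = reesGrading K A 𝒜 I d p) (j n : ℕ) (e : ℤ)
    (f : σ →₀ A) (he : d * j < e) (hf : ∀ i, f i ∈ I ^ j ∧ f i ∈ 𝒜 e)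
    (hfL : ∀ i, deg i ≠ ((n : ℤ), 0) → f i = 0) (hf0 : matrixAct (constantMatrix φ m) f = 0) :
    ∃ g : σ →₀ A, (∀ i, g i ∈ I ^ j ∧ g i ∈ 𝒜 (e - 1)) ∧
      (∀ i, deg i ≠ (((n + 1 : ℕ) : ℤ), 0) → g i = 0) ∧ matrixAct (constantMatrix φ m) g = f := by
  have hx : ∀ i, ∃ b ∈ ℬ (e - d * j, j), φ b = C (f i) * X ^ j := fun i =>
    exists_mem_rees hφ (hf i).1 (by rw [sub_add_cancel]; exact (hf i).2)
  choose b hb hbf using hx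
  have hb0 : ∀ i, f i = 0 → b i = 0 := fun i hi => hφinj (by
    rw [hbf, hi, map_zero, zero_mul, map_zero])
  let x : σ →₀ B := Finsupp.onFinset f.support b fun i hi =>
    Finsupp.mem_support_iff.mpr fun h' => hi (hb0 i h')
  have hxf : ∀ i, φ (x i) = C (f i) * X ^ j := hbf
  have hxL : ∀ i, deg i ≠ ((n : ℤ), 0) → x i = 0 := fun i hi => hb0 i (hfL i hi)
  obtain ⟨w, hw, hwx⟩ := h.stripExact j n (e - d * j + n) x (by omega)
    (fun i => ⟨by
      by_cases hi : deg i = ((n : ℤ), 0)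
      · rw [hi, Prod.mk_sub_mk, sub_zero, add_sub_cancel_right]
        exact hb i
      · rw [hxL i hi]
        exact zero_mem _, hxL i⟩)
    (Finsupp.ext fun l => hφinj (by
      rw [h.map_matrixAct hφ hxL hxf, hf0]
      simp))
  have hwg : ∀ i, ∃ a : A, a ∈ I ^ j ∧ a ∈ 𝒜 (e - 1) ∧ φ (w i) = C a * X ^ j := by
    intro i
    by_cases hi : deg i = (((n + 1 : ℕ) : ℤ), 0)
    · have h1 := (hw i).1
      rw [hi, Prod.mk_sub_mk, sub_zero] at h1
      obtain ⟨a, ha, ha', hae⟩ := exists_of_mem_rees hφ h1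
      refine ⟨a, ha, ?_, hae⟩
      rwa [show e - d * j + (n : ℤ) - ((n + 1 : ℕ) : ℤ) + d * j = e - 1 by push_cast; ring] at ha'
    · exact ⟨0, zero_mem _, zero_mem _, by rw [(hw i).2 hi]; simp⟩
  choose a ha ha' hae using hwg
  have ha0 : ∀ i, w i = 0 → a i = 0 := by
    intro i hi
    have h1 := congrArg (fun q => coeff q j) (hae i)
    simpa [hi] using h1.symm
  let g : σ →₀ A := Finsupp.onFinset w.support a fun i hi =>
    Finsupp.mem_support_iff.mpr fun h' => hi (ha0 i h')
  have hwL : ∀ i, deg i ≠ (((n + 1 : ℕ) : ℤ), 0) → w i = 0 := fun i => (hw i).2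
  refine ⟨g, fun i => ⟨ha i, ha' i⟩, fun i hi => ha0 i (hwL i hi), Finsupp.ext fun l => ?_⟩
  have h1 := h.map_matrixAct (f := g) hφ hwL hae l
  rw [hwx, hxf] at h1
  simpa using (congrArg (fun q => coeff q j) h1).symm

theorem linearComplex [GradedAlgebra ℬ] (h : LinearResolution ℬ deg m o)
    (hφinj : Function.Injective φ)
    (hφ : ∀ p, Submodule.map φ.toLinearMap (ℬ p) = reesGrading K A 𝒜 I d p) :
    LinearComplex 𝒜 (fun n i => deg i = ((n : ℤ), 0)) (constantMatrix φ m) o where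
  base := h.deg_base
  base_zero := Finsupp.ext fun l => by
    rw [constantMatrix_apply, h.entry_eq_zero (by rw [h.deg_base]; rfl), map_zero]
    rfl
  entry_mem n i l hi := (h.entry_of_lin hφ hi l).1
  step n i l hi hil := h.lin_step n i l hi fun h0 => hil (by
    rw [constantMatrix_apply, h0, map_zero])
  sq_zero f := constantMatrix_sq_zero h.sq_zero f
  exact := by
    intro n e f he hf hfL hf0
    obtain ⟨g, hg, hgL, hgf⟩ := h.exists_pow_preimage hφinj hφ 0 n e f (by simpa using he)
      (fun i => ⟨by simp, hf i⟩) hfL hf0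
    exact ⟨g, fun i => (hg i).2, hgL, hgf⟩

theorem isLinearModule_pow [GradedAlgebra 𝒜] [GradedAlgebra ℬ] (h : LinearResolution ℬ deg m o)
    (hneg : ∀ i < 0, 𝒜 i = ⊥) (hI : I = Ideal.span ((I : Set A) ∩ (𝒜 (d : ℤ) : Set A)))
    (hφinj : Function.Injective φ)
    (hφ : ∀ p, Submodule.map φ.toLinearMap (ℬ p) = reesGrading K A 𝒜 I d p) {j : ℕ}
    {P : Type} [AddCommGroup P] [Module A P] [Module K P] {Pc : ℤ → Submodule K P} {ψ : P →ₗ[K] A}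
    (hψ : Function.Injective ψ) (hψsmul : ∀ (x : A) (p : P), ψ (x • p) = x * ψ p)
    (hrange : Set.range ψ = ((I ^ j : Ideal A) : Set A))
    (hPc : ∀ i, Submodule.map ψ (Pc i) = Submodule.restrictScalars K (I ^ j : Ideal A) ⊓ 𝒜 i) :
    IsLinearModule 𝒜 (fun n i => deg i = ((n : ℤ), 0)) (constantMatrix φ m) Pc (d * j) := by
  have hmemI : ∀ p, ψ p ∈ I ^ j := fun p => hrange.subset ⟨p, rfl⟩
  have hmem : ∀ i p, p ∈ Pc i ↔ ψ p ∈ 𝒜 i := by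
    intro i p
    have h1 := SetLike.ext_iff.mp (hPc i) (ψ p)
    rw [Submodule.mem_inf, Submodule.restrictScalars_mem, and_iff_right (hmemI p)] at h1
    rw [← h1]
    exact (Function.Injective.mem_set_image hψ).symm
  have hlift : ∀ x ∈ I ^ j, ∃ p, ψ p = x := fun x hx => hrange.superset hx
  have hmap : ∀ f : σ →₀ P, Finsupp.mapRange.addMonoidHom ψ.toAddMonoidHom
      (matrixAct (constantMatrix φ m) f) =
        matrixAct (constantMatrix φ m) (Finsupp.mapRange.addMonoidHom ψ.toAddMonoidHom f) :=
    fun f => mapRange_matrixAct _ _ ψ.toAddMonoidHom f fun i l => hψsmul _ _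
  refine ⟨?_, ?_, ?_, ?_, ?_⟩
  · intro i k a ha p hp
    rw [hmem] at hp ⊢
    rw [hψsmul]
    exact SetLike.mul_mem_graded ha hp
  · intro p
    have hIhom : (I ^ j).IsHomogeneous 𝒜 := isHomogeneous_pow (by
      rw [hI]
      exact Ideal.homogeneous_span 𝒜 _ fun x hx => ⟨d, hx.2⟩) j
    choose f hf using fun k => hlift _ (hIhom k (hmemI p))
    classical
    refine ⟨(DirectSum.decompose 𝒜 (ψ p)).support, f, fun k => ?_, hψ ?_⟩
    · rw [hmem, hf]
      exact SetLike.coe_mem _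
    · rw [map_sum]
      simp only [hf]
      exact (DirectSum.sum_support_decompose 𝒜 (ψ p)).symm
  · intro t f hf h0 k hk
    refine hψ ((eq_zero_of_sum_of_graded 𝒜 t (fun k => ψ (f k)) (fun k => (hmem _ _).mp (hf k)) ?_
      k hk).trans (map_zero ψ).symm)
    rw [← map_sum, h0, map_zero]
  · intro k hk
    rw [eq_bot_iff]
    intro p hp
    rw [hmem] at hp
    have h1 := proj_eq_zero_of_mem_pow hneg hI j _ (hmemI p) k hk
    rw [GradedAlgebra.proj_apply, DirectSum.decompose_of_mem_same 𝒜 hp] at h1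
    exact (Submodule.mem_bot K).mpr (hψ (h1.trans (map_zero ψ).symm))
  · intro n e f he hf hfL hf0
    obtain ⟨g, hg, hgL, hgf⟩ := h.exists_pow_preimage hφinj hφ j n e
      (Finsupp.mapRange.addMonoidHom ψ.toAddMonoidHom f) he
      (fun i => ⟨hmemI _, (hmem _ _).mp (hf i)⟩)
      (fun i hi => (congrArg ψ (hfL i hi)).trans (map_zero ψ))
      (by rw [← hmap, hf0, map_zero])
    obtain ⟨q, hq⟩ := exists_finsupp_lift (fun _ => True) trivial ψ (map_zero ψ) g fun i => by
      obtain ⟨p, hp⟩ := hlift _ (hg i).1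
      exact ⟨p, trivial, hp⟩
    have hqg : Finsupp.mapRange.addMonoidHom ψ.toAddMonoidHom q = g :=
      Finsupp.ext fun i => (hq i).2.1
    refine ⟨q, fun i => ?_, fun i hi => (hq i).2.2 (hgL i hi), Finsupp.ext fun i => hψ ?_⟩
    · rw [hmem, (hq i).2.1]
      exact (hg i).2
    · have h1 := hmap q
      rw [hqg, hgf] at h1
      exact DFunLike.congr_fun h1 i

end LinearResolution

end Rees

theorem isLinearModule_residue {K A σ : Type} [Field K] [CommRing A] [Algebra K A]
    (𝒜 : ℤ → Submodule K A) (L : ℕ → σ → Prop) (m : σ → σ →₀ A) :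
    IsLinearModule 𝒜 L m (residueGrading K A 𝒜) 0 := by
  have hzero : ∀ k ≠ 0, residueGrading K A 𝒜 k = ⊥ := fun k hk => if_neg hk
  have htop : residueGrading K A 𝒜 0 = ⊤ := if_pos rfl
  refine ⟨?_, ?_, ?_, fun k hk => hzero k hk.ne, ?_⟩
  · intro i j a ha x hx
    rcases eq_or_ne j 0 with rfl | hj
    · rcases eq_or_ne i 0 with rfl | hi
      · rw [add_zero, htop]
        exact Submodule.mem_top
      · obtain ⟨b, rfl⟩ := Ideal.Quotient.mk_surjective x
        have h1 : a • Ideal.Quotient.mk (irrelevant 𝒜) b = 0 :=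
          Ideal.Quotient.eq_zero_iff_mem.mpr
            (Ideal.mul_mem_right b _ (Ideal.subset_span ⟨i, hi, ha⟩))
        rw [h1]
        exact zero_mem _
    · rw [hzero j hj, Submodule.mem_bot] at hx
      rw [hx, smul_zero]
      exact zero_mem _
  · intro x
    refine ⟨{0}, fun k => if k = 0 then x else 0, fun k => ?_, by simp⟩
    beta_reduce
    split_ifs with h
    · rw [h, htop]
      exact Submodule.mem_top
    · exact zero_mem _
  · intro t f hf h0 k hk
    have hne : ∀ k ≠ 0, f k = 0 := fun k hk => (Submodule.mem_bot K).mp (hzero k hk ▸ hf k)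
    rcases eq_or_ne k 0 with rfl | hk0
    · rwa [Finset.sum_eq_single_of_mem 0 hk fun k _ hk => hne k hk] at h0
    · exact hne k hk0
  · intro n e f he hf _ _
    refine ⟨0, fun i => zero_mem _, fun _ _ => rfl, Finsupp.ext fun i => ?_⟩
    have h1 := hf i
    rw [hzero e he.ne', Submodule.mem_bot] at h1
    rw [h1, map_zero]
    rfl

theorem nonempty_resolution_of_subsingleton {K A ι M : Type} [Field K] [CommRing A] [Algebra K A]
    [AddCommGroup ι] (𝒜 : ι → Submodule K A) [AddCommGroup M] [Module A M] [Module K M]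
    [Subsingleton M] (ℳ : ι → Submodule K M) (D : ℕ → Set ι) :
    Nonempty (GradedFreeResolution K A 𝒜 M ℳ D) :=
  ⟨{ σ := fun _ => Empty
     deg := fun _ i => i.elim
     deg_mem := fun _ i => i.elim
     aug := 0
     d := fun _ => 0
     aug_surjective := fun _ => ⟨0, Subsingleton.elim _ _⟩
     aug_graded := fun _ _ _ => zero_mem _
     d_graded := fun _ _ _ _ => zero_mem _
     exact_zero := Subsingleton.elim _ _
     exact_succ := fun _ => Subsingleton.elim _ _ }⟩

/-- **Corollary.**  Let `A` be a standard graded `K`-algebra and `I ⊆ A` a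
homogeneous ideal generated in the single degree `d`, such that the Rees algebra
`R(I) = A[It]` (standard bigraded with `deg m = (1,0)` and `deg (f_i t) = (0,1)`) is
Koszul.  Then `A` is Koszul, and for every `j ≥ 0` the power `I^j` has a linear
`A`-resolution: `Tor_i^A(I^j, K)_k = 0` for `k ≠ i + dj`, i.e. `I^j` admits a graded
free resolution whose `i`-th free module has generators in the single degree
`dj + i`.  The Rees algebra is represented by a bigraded `K`-algebra `B` with an
injective algebra homomorphism into `A[t]` matching the bigraded components, and
`I^j` by a graded `A`-module `P` with a compatible injective map onto `I^j`. -/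
theorem rees_koszul_powers_linear
    (K A : Type) [Field K] [CommRing A] [Algebra K A]
    (𝒜 : ℤ → Submodule K A) [GradedAlgebra 𝒜]
    (hstd : IsStandardGraded K A 𝒜)
    (I : Ideal A) (d : ℕ)
    (hIdeg : I = Ideal.span ((I : Set A) ∩ (𝒜 (d : ℤ) : Set A)))
    -- the Rees algebra R(I), bigraded, assumed Koszul
    (B : Type) [CommRing B] [Algebra K B]
    (ℬ : ℤ × ℤ → Submodule K B) [GradedAlgebra ℬ]
    (φ : B →ₐ[K] Polynomial A) (hφinj : Function.Injective φ)
    (hφ : ∀ p : ℤ × ℤ, Submodule.map φ.toLinearMap (ℬ p) = reesGrading K A 𝒜 I d p)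
    (hkoszul : IsKoszulBi K B ℬ) :
    IsKoszul K A 𝒜 ∧
    (∀ j : ℕ,
      ∀ (P : Type) [AddCommGroup P] [Module A P] [Module K P]
        (Pc : ℤ → Submodule K P) (ψ : P →ₗ[K] A),
        Function.Injective ψ →
        (∀ (x : A) (p : P), ψ (x • p) = x * ψ p) →
        Set.range ψ = ((I ^ j : Ideal A) : Set A) →
        (∀ i : ℤ, Submodule.map ψ (Pc i) =
          Submodule.restrictScalars K (I ^ j : Ideal A) ⊓ 𝒜 i) →
        Nonempty (GradedFreeResolution K A 𝒜 P Pc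
          (fun i => {k : ℤ | k = d * j + i}))) := by
  have hneg := hstd.1
  have hzero := hstd.2.1
  rcases subsingleton_or_nontrivial A with hA | hA
  · refine ⟨?_, fun j P _ _ _ Pc ψ hψ _ _ _ => ?_⟩
    · have : Subsingleton (A ⧸ irrelevant 𝒜) := Ideal.Quotient.mk_surjective.subsingleton
      exact nonempty_resolution_of_subsingleton _ _ _
    · have := hψ.subsingleton
      exact nonempty_resolution_of_subsingleton _ _ _
  · have : Nontrivial B := φ.toRingHom.domain_nontrivial
    obtain ⟨σ, deg, m, o, h⟩ := exists_linearResolution (rees_eq_bot hneg hIdeg hφinj hφ)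
      (rees_zero hzero hφinj hφ) hkoszul
    have hc := h.linearComplex hφinj hφ
    refine ⟨(isLinearModule_residue 𝒜 _ _).nonempty_resolution hneg hzero hc _ fun s => zero_add _,
      fun j P _ _ _ Pc ψ hψ hψsmul hrange hPc => ?_⟩
    have : IsScalarTower K A P := ⟨fun c a p => hψ (by
      rw [hψsmul, map_smul, hψsmul, smul_mul_assoc])⟩
    exact (h.isLinearModule_pow hneg hIdeg hφinj hφ hψ hψsmul hrange hPc).nonempty_resolution
      hneg hzero hc _ fun s => rfl
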